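/- arXiv:1911.03253 — 4 statements merged into one kernel-verified Lean document; each statement's English description precedes it below -/
import Mathlib

section
/- Let 1/2 < b ≤ 5/6. There exists a constant C > 0, depending only on b and C₀ (and independent of N), such that for every N ≥ 1, every multiplier m as in the context, and every smooth compactly supported function u : ℝ_t × ℝ_x → ℂ with support contained in {(t,x) : |t| ≤ 2}, one has ‖I(u · conj(u) · u)‖_{X^{0,b−1}} ≤ C ‖Iu‖_{X^{0,b}}³, where conj denotes complex conjugation and I acts in the spatial variable. -/
open MeasureTheory Complex
open scoped ENNReal

/-- `m` is the `I`-method multiplier at level `N` (with `s = -1/2`), with derivative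
bounds of constant `C₀`. -/
def IsIMultiplier (N C₀ : ℝ) (m : ℝ → ℝ) : Prop :=
  ContDiff ℝ (⊤ : ℕ∞) m ∧ (∀ ξ, m (-ξ) = m ξ) ∧ (∀ ξ, m ξ ∈ Set.Icc (0:ℝ) 1) ∧
  (∀ a b : ℝ, 0 ≤ a → a ≤ b → m b ≤ m a) ∧
  (∀ ξ : ℝ, |ξ| ≤ N → m ξ = 1) ∧
  (∀ ξ : ℝ, 2 * N ≤ |ξ| → m ξ = (|ξ| / N) ^ (-(1/2) : ℝ)) ∧
  (∀ ξ : ℝ, ξ ≠ 0 → |deriv (fun x => (m x)^2) ξ| ≤ C₀ * (m ξ)^2 / |ξ|) ∧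
  (∀ ξ : ℝ, ξ ≠ 0 → |deriv (deriv (fun x => (m x)^2)) ξ| ≤ C₀ * (m ξ)^2 / ξ^2)

/-- The spatial Fourier transform `û(t,ξ) = ∫ e^{-ixξ} u(t,x) dx`. -/
noncomputable def fourierIntX (u : ℝ × ℝ → ℂ) (t ξ : ℝ) : ℂ :=
  ∫ x : ℝ, Complex.exp (-(Complex.I * x * ξ)) * u (t, x)

/-- The operator `I` acting in the spatial variable, `(Iu)^(t,ξ) = m(ξ) û(t,ξ)`,
realized in physical space. -/
noncomputable def IopST (m : ℝ → ℝ) (u : ℝ × ℝ → ℂ) (p : ℝ × ℝ) : ℂ :=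
  (2 * Real.pi)⁻¹ * ∫ ξ : ℝ, Complex.exp (Complex.I * p.2 * ξ) * (m ξ : ℂ) * fourierIntX u p.1 ξ

/-- The space-time Fourier transform `ũ(τ,ξ) = ∫∫ e^{-i(tτ+xξ)} u(t,x) dt dx`. -/
noncomputable def spaceTimeFT (u : ℝ × ℝ → ℂ) (τ ξ : ℝ) : ℂ :=
  ∫ p : ℝ × ℝ, Complex.exp (-(Complex.I * (p.1 * τ + p.2 * ξ))) * u p

/-- The Bourgain norm `‖u‖_{X^{s,b}} = ‖⟨ξ⟩^s ⟨τ+ξ⁴⟩^b ũ(τ,ξ)‖_{L²_{τ,ξ}}`. -/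
noncomputable def Xnorm (s b : ℝ) (u : ℝ × ℝ → ℂ) : ℝ≥0∞ :=
  eLpNorm (fun q : ℝ × ℝ =>
    (((1 + q.2^2) ^ (s/2) * (1 + (q.1 + q.2^4)^2) ^ (b/2) : ℝ) : ℂ) *
      spaceTimeFT u q.1 q.2) 2 volume

open FourierTransform SchwartzMap

theorem IsIMultiplier.hasTemperateGrowth {N C₀ : ℝ} (hN : 1 ≤ N) {m : ℝ → ℝ}
    (hm : IsIMultiplier N C₀ m) : m.HasTemperateGrowth := by
  obtain ⟨hsm, heven, -, -, -, htail, -⟩ := hm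
  refine ⟨hsm, fun n => ?_⟩
  have hcont : Continuous fun x => ‖iteratedFDeriv ℝ n m x‖ :=
    (hsm.continuous_iteratedFDeriv (by exact_mod_cast le_top)).norm
  obtain ⟨C, hC⟩ := (isCompact_Icc (a := -(2 * N)) (b := 2 * N)).exists_bound_of_continuousOn
    hcont.continuousOn
  have hpos : ∀ x, 2 * N < x → ‖iteratedFDeriv ℝ n m x‖ ≤
      N ^ (1 / 2 : ℝ) * |(descPochhammer ℝ n).eval (-(1 / 2) : ℝ)| := by
    intro x hx
    have hx1 : 1 ≤ x := by linarith
    have hev : m =ᶠ[nhds x] fun y => N ^ (1 / 2 : ℝ) * y ^ (-(1 / 2) : ℝ) := by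
      filter_upwards [lt_mem_nhds hx] with y hy
      have hy0 : 0 < y := by linarith
      rw [htail y (by rw [abs_of_pos hy0]; exact hy.le), abs_of_pos hy0,
        Real.div_rpow hy0.le (by linarith), Real.rpow_neg (x := N) (by linarith), div_inv_eq_mul,
        mul_comm]
    rw [norm_iteratedFDeriv_eq_norm_iteratedDeriv, hev.iteratedDeriv_eq n,
      iteratedDeriv_const_mul_field, iteratedDeriv_eq_iterate, Real.iter_deriv_rpow_const,
      norm_mul, norm_mul, Real.norm_of_nonneg (by positivity), Real.norm_eq_abs, Real.norm_eq_abs,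
      abs_of_nonneg (Real.rpow_nonneg (by linarith : (0:ℝ) ≤ x) _)]
    have : x ^ (-(1 / 2) - (n : ℝ)) ≤ 1 :=
      Real.rpow_le_one_of_one_le_of_nonpos hx1 (by
        have : (0 : ℝ) ≤ n := n.cast_nonneg
        linarith)
    have h0 : 0 ≤ N ^ (1 / 2 : ℝ) := by positivity
    exact mul_le_mul_of_nonneg_left (mul_le_of_le_one_right (abs_nonneg _) this) h0
  have hneg : ∀ x, ‖iteratedFDeriv ℝ n m (-x)‖ = ‖iteratedFDeriv ℝ n m x‖ := by
    intro x
    have h := iteratedDeriv_comp_neg n m x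
    rw [funext heven] at h
    rw [norm_iteratedFDeriv_eq_norm_iteratedDeriv, norm_iteratedFDeriv_eq_norm_iteratedDeriv, h,
      norm_smul]
    simp
  refine ⟨0, max C (N ^ (1 / 2 : ℝ) * |(descPochhammer ℝ n).eval (-(1 / 2) : ℝ)|), fun x => ?_⟩
  rw [pow_zero, mul_one]
  rcases lt_or_ge (2 * N) x with h | h
  · exact (hpos x h).trans (le_max_right _ _)
  rcases lt_or_ge x (-(2 * N)) with h' | h'
  · rw [← hneg]
    exact (hpos (-x) (by linarith)).trans (le_max_right _ _)
  · have := hC x ⟨h', h⟩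
    rw [norm_norm] at this
    exact this.trans (le_max_left _ _)

theorem IsIMultiplier.hasTemperateGrowth_symbol {N C₀ : ℝ} (hN : 1 ≤ N) {m : ℝ → ℝ}
    (hm : IsIMultiplier N C₀ m) :
    (fun z : ℂ => ((m (2 * Real.pi * z.im) : ℝ) : ℂ)).HasTemperateGrowth := by
  have h1 : (fun z : ℂ => 2 * Real.pi * z.im).HasTemperateGrowth :=
    ((2 * Real.pi) • Complex.imCLM).hasTemperateGrowth
  exact Function.Complex.hasTemperateGrowth_ofReal.comp ((hm.hasTemperateGrowth hN).comp h1)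

theorem integral_comp_re_im {E : Type*} [NormedAddCommGroup E] [NormedSpace ℝ E]
    (f : ℝ × ℝ → E) : ∫ z : ℂ, f (z.re, z.im) = ∫ p, f p :=
  Complex.volume_preserving_equiv_real_prod.integral_comp
    Complex.measurableEquivRealProd.measurableEmbedding f

theorem spaceTimeFT_eq_fourier (u : ℝ × ℝ → ℂ) (τ ξ : ℝ) :
    spaceTimeFT u τ ξ =
      𝓕 (fun z : ℂ => u (z.re, z.im)) ⟨τ / (2 * Real.pi), ξ / (2 * Real.pi)⟩ := by
  rw [Real.fourier_eq', spaceTimeFT, ← integral_comp_re_im]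
  congr 1 with z
  rw [smul_eq_mul]
  congr 2
  have hpi : (Real.pi : ℂ) ≠ 0 := by exact_mod_cast Real.pi_ne_zero
  simp only [Complex.inner, Complex.mul_re, Complex.conj_re, Complex.conj_im]
  push_cast
  field_simp
  ring

theorem fourier_eq_spaceTimeFT (u : ℝ × ℝ → ℂ) (z : ℂ) :
    𝓕 (fun z : ℂ => u (z.re, z.im)) z =
      spaceTimeFT u (2 * Real.pi * z.re) (2 * Real.pi * z.im) := by
  rw [spaceTimeFT_eq_fourier]
  apply Complex.ext <;> simp [Real.pi_ne_zero]

/-- A smooth compactly supported function on `ℝ × ℝ`, as a Schwartz function on `ℂ`. -/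
noncomputable def schwartzOfPlane (u : ℝ × ℝ → ℂ) (hu : ContDiff ℝ (⊤ : ℕ∞) u)
    (hc : HasCompactSupport u) : 𝓢(ℂ, ℂ) :=
  HasCompactSupport.toSchwartzMap
    (f := fun z : ℂ => u (z.re, z.im))
    (hc.comp_homeomorph Complex.equivRealProdCLM.toHomeomorph)
    (hu.comp Complex.equivRealProdCLM.contDiff)

theorem schwartzOfPlane_coe (u : ℝ × ℝ → ℂ) (hu : ContDiff ℝ (⊤ : ℕ∞) u)
    (hc : HasCompactSupport u) :
    (schwartzOfPlane u hu hc : ℂ → ℂ) = fun z : ℂ => u (z.re, z.im) := rfl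

theorem fourier_mul_eq_convolution (f g : 𝓢(ℂ, ℂ)) (x : ℂ) :
    𝓕 (fun z => f z * g z) x = ∫ w, 𝓕 (f : ℂ → ℂ) w * 𝓕 (g : ℂ → ℂ) (x - w) := by
  have h1 := SchwartzMap.convolution_apply (ContinuousLinearMap.mul ℂ ℂ) (𝓕 f) (𝓕 g) x
  have h2 : SchwartzMap.convolution (ContinuousLinearMap.mul ℂ ℂ) (𝓕 f) (𝓕 g) x =
      𝓕⁻ (SchwartzMap.pairing (ContinuousLinearMap.mul ℂ ℂ) (𝓕 (𝓕 f)) (𝓕 (𝓕 g))) x := by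
    rw [← SchwartzMap.fourier_convolution, FourierTransform.fourierInv_fourier_eq]
  have h3 : ∀ (h : 𝓢(ℂ, ℂ)) (z : ℂ), 𝓕 (𝓕 h) (-z) = h z := by
    intro h z
    have : 𝓕⁻ (𝓕 h) z = h z := by rw [FourierTransform.fourierInv_fourier_eq]
    rw [← this, SchwartzMap.fourierInv_coe, Real.fourierInv_eq_fourier_neg,
      SchwartzMap.fourier_coe]
  rw [h2, SchwartzMap.fourierInv_coe, Real.fourierInv_eq_fourier_comp_neg] at h1
  simp only [SchwartzMap.pairing_apply_apply, h3, ContinuousLinearMap.mul_apply'] at h1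
  rw [h1]
  rfl

theorem spaceTimeFT_mul (u v : ℝ × ℝ → ℂ) (hu : ContDiff ℝ (⊤ : ℕ∞) u) (hcu : HasCompactSupport u)
    (hv : ContDiff ℝ (⊤ : ℕ∞) v) (hcv : HasCompactSupport v) (q : ℝ × ℝ) :
    spaceTimeFT (fun p => u p * v p) q.1 q.2 = (((2 * Real.pi) ^ 2)⁻¹ : ℝ) •
      ∫ p : ℝ × ℝ, spaceTimeFT u p.1 p.2 * spaceTimeFT v (q - p).1 (q - p).2 := by
  have hpi : (2 * Real.pi) ≠ 0 := by positivity
  have key := fourier_mul_eq_convolution (schwartzOfPlane u hu hcu) (schwartzOfPlane v hv hcv)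
    ⟨q.1 / (2 * Real.pi), q.2 / (2 * Real.pi)⟩
  have hsc := Measure.integral_comp_smul (μ := (volume : Measure (ℝ × ℝ)))
    (fun p : ℝ × ℝ => spaceTimeFT u p.1 p.2 * spaceTimeFT v (q - p).1 (q - p).2) (2 * Real.pi)
  rw [Module.finrank_prod, Module.finrank_self, abs_of_pos (by positivity)] at hsc
  rw [← hsc, spaceTimeFT_eq_fourier, ← integral_comp_re_im]
  refine key.trans ?_
  congr 1 with w
  simp only [schwartzOfPlane_coe]
  rw [fourier_eq_spaceTimeFT, fourier_eq_spaceTimeFT]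
  congr 2 <;> simp <;> field_simp

theorem spaceTimeFT_conj (u : ℝ × ℝ → ℂ) (τ ξ : ℝ) :
    spaceTimeFT (fun p => (starRingEnd ℂ) (u p)) τ ξ =
      (starRingEnd ℂ) (spaceTimeFT u (-τ) (-ξ)) := by
  rw [spaceTimeFT, spaceTimeFT, ← integral_conj]
  congr 1 with p
  rw [map_mul, ← Complex.exp_conj]
  congr 2
  simp
  ring

theorem continuous_spaceTimeFT (u : ℝ × ℝ → ℂ) (hu : ContDiff ℝ (⊤ : ℕ∞) u)
    (hc : HasCompactSupport u) : Continuous fun q : ℝ × ℝ => spaceTimeFT u q.1 q.2 := by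
  simp only [spaceTimeFT_eq_fourier]
  have h : Continuous (𝓕 (fun z : ℂ => u (z.re, z.im))) :=
    (𝓕 (schwartzOfPlane u hu hc)).continuous
  refine h.comp ((Complex.equivRealProdCLM.symm.continuous).comp
    (f := fun q : ℝ × ℝ => (q.1 / (2 * Real.pi), q.2 / (2 * Real.pi))) ?_)
  fun_prop

theorem IopST_eq_fourierInv {m : ℝ → ℝ} (v : ℝ × ℝ → ℂ) (hv : ContDiff ℝ (⊤ : ℕ∞) v)
    (hc : HasCompactSupport v) (G : 𝓢(ℂ, ℂ))
    (hG : ∀ z : ℂ, G z =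
      (m (2 * Real.pi * z.im) : ℂ) * spaceTimeFT v (2 * Real.pi * z.re) (2 * Real.pi * z.im))
    (p : ℝ × ℝ) : IopST m v p = 𝓕⁻ (G : ℂ → ℂ) ⟨p.1, p.2⟩ := by
  have hpi : (0 : ℝ) < 2 * Real.pi := by positivity
  have hcont := hv.continuous
  obtain ⟨R, hR⟩ := hc.isCompact.isBounded.subset_closedBall 0
  have hsupp : ∀ t x, R < |t| ∨ R < |x| → v (t, x) = 0 := by
    intro t x h
    by_contra hne
    have := hR (subset_closure (Function.mem_support.2 hne))
    rw [mem_closedBall_zero_iff, Prod.norm_def] at this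
    simp only [Real.norm_eq_abs, sup_le_iff] at this
    rcases h with h | h <;> linarith
  have hacont : ∀ ξ, Continuous fun t => fourierIntX v t ξ := by
    intro ξ
    obtain ⟨B, hB⟩ := hcont.bounded_above_of_compact_support hc
    refine continuous_of_dominated (bound := (Set.Icc (-R) R).indicator fun _ => B) ?_ ?_ ?_ ?_
    · intro t
      exact Continuous.aestronglyMeasurable (by fun_prop)
    · intro t
      refine Filter.Eventually.of_forall fun x => ?_
      by_cases hx : x ∈ Set.Icc (-R) R
      · rw [Set.indicator_of_mem hx, norm_mul, Complex.norm_exp]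
        simpa using hB (t, x)
      · have : R < |x| := by
          rw [Set.mem_Icc, ← abs_le] at hx
          exact not_le.1 hx
        simp [Set.indicator_of_notMem hx, hsupp t x (Or.inr this)]
    · exact (integrable_indicator_iff measurableSet_Icc).2 (integrableOn_const (by simp) (by simp))
    · exact Filter.Eventually.of_forall fun x => by fun_prop
  have hacpt : ∀ ξ, HasCompactSupport fun t => fourierIntX v t ξ := by
    intro ξ
    refine HasCompactSupport.intro (isCompact_Icc (a := -R) (b := R)) fun t ht => ?_
    have : R < |t| := by
      rw [Set.mem_Icc, ← abs_le] at ht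
      exact not_le.1 ht
    simp [fourierIntX, hsupp t _ (Or.inl this)]
  have hft : ∀ κ ξ, 𝓕 (fun t => fourierIntX v t ξ) κ = spaceTimeFT v (2 * Real.pi * κ) ξ := by
    intro κ ξ
    rw [Real.fourier_eq', spaceTimeFT, Measure.volume_eq_prod, integral_prod]
    · congr 1 with t
      rw [fourierIntX, smul_eq_mul, ← integral_const_mul]
      congr 1 with x
      rw [← mul_assoc, ← Complex.exp_add]
      congr 2
      simp
      ring
    · rw [← Measure.volume_eq_prod]
      exact (Continuous.integrable_of_hasCompactSupport (by fun_prop) hc.mul_left)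
  have hline : ∀ ξ, Integrable (𝓕 (fun t => fourierIntX v t ξ)) := by
    intro ξ
    set H := 𝓕 (schwartzOfPlane v hv hc) with hH
    have hval : ∀ κ, 𝓕 (fun t => fourierIntX v t ξ) κ = H ⟨κ, ξ / (2 * Real.pi)⟩ := by
      intro κ
      rw [hft, hH, SchwartzMap.fourier_coe, schwartzOfPlane_coe, fourier_eq_spaceTimeFT]
      congr 1
      field_simp
    obtain ⟨C0, hC0, h0⟩ := H.decay 0 0
    obtain ⟨C2, hC2, h2⟩ := H.decay 2 0
    refine Integrable.mono' (g := fun κ => (C0 + C2) * (1 + κ ^ 2)⁻¹)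
      (integrable_inv_one_add_sq.const_mul _) ?_ (Filter.Eventually.of_forall fun κ => ?_)
    · refine Continuous.aestronglyMeasurable ?_
      rw [funext hval]
      exact H.continuous.comp (Complex.equivRealProdCLM.symm.continuous.comp
        (f := fun κ : ℝ => (κ, ξ / (2 * Real.pi))) (by fun_prop))
    · rw [hval, ← div_eq_mul_inv, le_div_iff₀ (by positivity)]
      have a0 := h0 ⟨κ, ξ / (2 * Real.pi)⟩
      have a2 := h2 ⟨κ, ξ / (2 * Real.pi)⟩
      rw [norm_iteratedFDeriv_zero] at a0 a2
      have hn : κ ^ 2 ≤ ‖(⟨κ, ξ / (2 * Real.pi)⟩ : ℂ)‖ ^ 2 := by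
        rw [← Complex.normSq_eq_norm_sq, Complex.normSq_mk]
        nlinarith [mul_self_nonneg (ξ / (2 * Real.pi))]
      have := mul_le_mul_of_nonneg_right hn (norm_nonneg (H ⟨κ, ξ / (2 * Real.pi)⟩))
      rw [pow_zero, one_mul] at a0
      linarith
  have hinv : ∀ ξ t, ∫ κ : ℝ, Complex.exp ((2 * Real.pi * (κ * t) : ℝ) * Complex.I) *
      spaceTimeFT v (2 * Real.pi * κ) ξ = fourierIntX v t ξ := by
    intro ξ t
    have h := congrFun ((hacont ξ).fourierInv_fourier_eq
      ((hacont ξ).integrable_of_hasCompactSupport (hacpt ξ)) (hline ξ)) t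
    rw [Real.fourierInv_eq'] at h
    rw [← h]
    congr 1 with κ
    rw [hft]
    simp [mul_comm]
  have hGint : Integrable fun q : ℝ × ℝ => Complex.exp
      (((2 * Real.pi * (q.1 * p.1 + q.2 * p.2) : ℝ) : ℂ) * Complex.I) *
        ((m (2 * Real.pi * q.2) : ℂ) * spaceTimeFT v (2 * Real.pi * q.1) (2 * Real.pi * q.2)) := by
    have h1 : Integrable fun q : ℝ × ℝ => G ⟨q.1, q.2⟩ :=
      (Complex.volume_preserving_equiv_real_prod.symm.integrable_comp_emb
        Complex.measurableEquivRealProd.symm.measurableEmbedding).2 G.integrable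
    simp only [hG] at h1
    refine h1.bdd_mul (c := 1) (Continuous.aestronglyMeasurable (by fun_prop)) ?_
    exact Filter.Eventually.of_forall fun q => by rw [Complex.norm_exp_ofReal_mul_I]
  have hscale := Measure.integral_comp_mul_left (fun ξ : ℝ =>
    Complex.exp (Complex.I * p.2 * ξ) * (m ξ : ℂ) * fourierIntX v p.1 ξ) (2 * Real.pi)
  rw [abs_of_pos (inv_pos.2 hpi)] at hscale
  rw [Real.fourierInv_eq', IopST]
  have hre := integral_comp_re_im (fun q : ℝ × ℝ => Complex.exp
      (((2 * Real.pi * (q.1 * p.1 + q.2 * p.2) : ℝ) : ℂ) * Complex.I) *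
        ((m (2 * Real.pi * q.2) : ℂ) * spaceTimeFT v (2 * Real.pi * q.1) (2 * Real.pi * q.2)))
  have hL : ∫ z : ℂ, Complex.exp ((2 * Real.pi * inner ℝ z (⟨p.1, p.2⟩ : ℂ) : ℝ) * Complex.I) •
      G z = ∫ z : ℂ, (fun q : ℝ × ℝ => Complex.exp
      (((2 * Real.pi * (q.1 * p.1 + q.2 * p.2) : ℝ) : ℂ) * Complex.I) *
        ((m (2 * Real.pi * q.2) : ℂ) * spaceTimeFT v (2 * Real.pi * q.1) (2 * Real.pi * q.2)))
        (z.re, z.im) := by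
    congr 1 with z
    rw [hG, smul_eq_mul]
    congr 4
    simp [Complex.inner]
    ring
  rw [hL, hre, Measure.volume_eq_prod, integral_prod_symm _ (by rwa [← Measure.volume_eq_prod])]
  rw [← Complex.real_smul, ← hscale]
  congr 1 with η
  rw [← hinv (2 * Real.pi * η) p.1, ← integral_const_mul]
  congr 1 with κ
  have : Complex.exp (((2 * Real.pi * (κ * p.1 + η * p.2) : ℝ) : ℂ) * Complex.I) =
      Complex.exp (Complex.I * p.2 * (2 * Real.pi * η : ℝ)) *
        Complex.exp ((2 * Real.pi * (κ * p.1) : ℝ) * Complex.I) := by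
    rw [← Complex.exp_add]
    congr 1
    push_cast
    ring
  rw [this]
  ring

theorem spaceTimeFT_IopST {N C₀ : ℝ} (hN : 1 ≤ N) {m : ℝ → ℝ} (hm : IsIMultiplier N C₀ m)
    (v : ℝ × ℝ → ℂ) (hv : ContDiff ℝ (⊤ : ℕ∞) v) (hc : HasCompactSupport v) (τ ξ : ℝ) :
    spaceTimeFT (IopST m v) τ ξ = (m ξ : ℂ) * spaceTimeFT v τ ξ := by
  set G : 𝓢(ℂ, ℂ) := SchwartzMap.smulLeftCLM ℂ
    (fun z : ℂ => ((m (2 * Real.pi * z.im) : ℝ) : ℂ)) (𝓕 (schwartzOfPlane v hv hc)) with hGdef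
  have hG : ∀ z : ℂ, G z = (m (2 * Real.pi * z.im) : ℂ) *
      spaceTimeFT v (2 * Real.pi * z.re) (2 * Real.pi * z.im) := by
    intro z
    rw [hGdef, SchwartzMap.smulLeftCLM_apply_apply (hm.hasTemperateGrowth_symbol hN),
      SchwartzMap.fourier_coe, schwartzOfPlane_coe, fourier_eq_spaceTimeFT, smul_eq_mul]
  have hI : (fun z : ℂ => IopST m v (z.re, z.im)) = (𝓕⁻ G : 𝓢(ℂ, ℂ)) := by
    ext z
    rw [IopST_eq_fourierInv v hv hc G hG, SchwartzMap.fourierInv_coe]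
  rw [spaceTimeFT_eq_fourier, hI, ← SchwartzMap.fourier_coe, FourierTransform.fourier_fourierInv_eq,
    hG]
  have hpi : (2 * Real.pi) ≠ 0 := by positivity
  congr 2 <;> field_simp

/-- The Japanese bracket `⟨x⟩ = (1 + x²)^{1/2}`. -/
noncomputable def japaneseBracket (x : ℝ) : ℝ := √(1 + x ^ 2)

local notation "⟪" x "⟫" => japaneseBracket x

theorem japaneseBracket_sq (x : ℝ) : ⟪x⟫ ^ 2 = 1 + x ^ 2 := Real.sq_sqrt (by positivity)

theorem one_le_japaneseBracket (x : ℝ) : 1 ≤ ⟪x⟫ := by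
  rw [japaneseBracket, Real.one_le_sqrt]
  nlinarith [sq_nonneg x]

theorem japaneseBracket_pos (x : ℝ) : 0 < ⟪x⟫ := one_pos.trans_le (one_le_japaneseBracket x)

theorem abs_le_japaneseBracket (x : ℝ) : |x| ≤ ⟪x⟫ := by
  refine abs_le_of_sq_le_sq ?_ (japaneseBracket_pos x).le
  rw [japaneseBracket_sq]
  linarith

theorem japaneseBracket_le (x : ℝ) : ⟪x⟫ ≤ 1 + |x| := by
  rw [japaneseBracket, Real.sqrt_le_left (by positivity)]
  nlinarith [abs_nonneg x, sq_abs x]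

theorem japaneseBracket_neg (x : ℝ) : ⟪-x⟫ = ⟪x⟫ := by simp [japaneseBracket]

@[fun_prop]
theorem continuous_japaneseBracket : Continuous japaneseBracket := by
  unfold japaneseBracket
  fun_prop

theorem japaneseBracket_rpow (x b : ℝ) : ⟪x⟫ ^ b = (1 + x ^ 2) ^ (b / 2) := by
  rw [japaneseBracket, Real.sqrt_eq_rpow, ← Real.rpow_mul (by positivity)]
  ring_nf

theorem IsIMultiplier.sq_eq {N C₀ : ℝ} (hN : 1 ≤ N) {m : ℝ → ℝ} (hm : IsIMultiplier N C₀ m)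
    {ξ : ℝ} (h : 2 * N ≤ |ξ|) : m ξ ^ 2 = N / |ξ| := by
  have h0 : 0 < |ξ| := by linarith
  rw [hm.2.2.2.2.2.1 ξ h, ← Real.rpow_natCast, ← Real.rpow_mul (by positivity)]
  norm_num
  rw [Real.rpow_neg_one, inv_div]

theorem IsIMultiplier.pos {N C₀ : ℝ} (hN : 1 ≤ N) {m : ℝ → ℝ} (hm : IsIMultiplier N C₀ m)
    (ξ : ℝ) : 0 < m ξ := by
  rcases le_total (2 * N) |ξ| with h | h
  · rw [hm.2.2.2.2.2.1 ξ h]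
    have h0 : 0 < |ξ| := by linarith
    positivity
  · have habs : m |ξ| = m ξ := by
      rcases abs_choice ξ with h | h <;> rw [h]
      exact hm.2.1 ξ
    rw [← habs]
    refine lt_of_lt_of_le ?_ (hm.2.2.2.1 _ _ (abs_nonneg ξ) h)
    rw [hm.2.2.2.2.2.1 (2 * N) (le_abs_self _)]
    have h0 : 0 < |2 * N| := by positivity
    positivity

theorem IsIMultiplier.sq_mul_japaneseBracket_le {N C₀ : ℝ} (hN : 1 ≤ N) {m : ℝ → ℝ}
    (hm : IsIMultiplier N C₀ m) (ξ η : ℝ) :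
    m ξ ^ 2 * ⟪ξ⟫ ≤ 4 * max ⟪ξ⟫ ⟪η⟫ * m η ^ 2 := by
  have hle : ∀ x, m x ^ 2 ≤ 1 := fun x => pow_le_one₀ (hm.2.2.1 x).1 (hm.2.2.1 x).2
  have hX := japaneseBracket_pos ξ
  rcases le_total (2 * N) |η| with h | h
  · have h0 : 0 < |η| := by linarith
    have hL : m ξ ^ 2 * ⟪ξ⟫ ≤ 3 * N := by
      rcases le_total (2 * N) |ξ| with h' | h'
      · have h0' : 0 < |ξ| := by linarith
        rw [hm.sq_eq hN h', div_mul_eq_mul_div, div_le_iff₀ h0']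
        nlinarith [japaneseBracket_le ξ]
      · nlinarith [japaneseBracket_le ξ, hle ξ]
    refine hL.trans ?_
    rw [hm.sq_eq hN h, mul_div_assoc', le_div_iff₀ h0]
    nlinarith [abs_le_japaneseBracket η, le_max_right ⟪ξ⟫ ⟪η⟫]
  · have habs : m |η| = m η := by
      rcases abs_choice η with h | h <;> rw [h]
      exact hm.2.1 η
    have h2 : m (2 * N) ^ 2 = 1 / 2 := by
      rw [hm.sq_eq hN (le_abs_self _), abs_of_pos (by linarith)]
      field_simp
    have h3 : 1 / 2 ≤ m η ^ 2 := by
      rw [← h2, ← habs]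
      exact pow_le_pow_left₀ (hm.2.2.1 _).1 (hm.2.2.2.1 _ _ (abs_nonneg η) h) 2
    nlinarith [hle ξ, le_max_left ⟪ξ⟫ ⟪η⟫]

theorem IsIMultiplier.one_le_mul {N C₀ : ℝ} (hN : 1 ≤ N) {m : ℝ → ℝ}
    (hm : IsIMultiplier N C₀ m) (η : ℝ) : 1 ≤ 4 * ⟪η⟫ * m η ^ 2 := by
  have h := hm.sq_mul_japaneseBracket_le hN 0 η
  have h1 : ⟪(0 : ℝ)⟫ = 1 := by simp [japaneseBracket]
  rw [hm.2.2.2.2.1 0 (by simpa using by linarith), h1,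
    max_eq_right (one_le_japaneseBracket η)] at h
  linarith

/-- If one input frequency is dominated by the output frequency, the two others absorb the
quotient of multipliers. -/
theorem IsIMultiplier.le_of_japaneseBracket_le {N C₀ : ℝ} (hN : 1 ≤ N) {m : ℝ → ℝ}
    (hm : IsIMultiplier N C₀ m) {x y z w : ℝ} (h : ⟪y⟫ ≤ 4 * ⟪x⟫) :
    m x ≤ 16 * (m y * m z * m w) * (⟪z⟫ ^ (1 / 2 : ℝ) * ⟪w⟫ ^ (1 / 2 : ℝ)) := by
  have hX := japaneseBracket_pos x
  have h1 : m x ^ 2 ≤ 16 * m y ^ 2 := by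
    have := hm.sq_mul_japaneseBracket_le hN x y
    have h4 : max ⟪x⟫ ⟪y⟫ ≤ 4 * ⟪x⟫ := max_le (by linarith) h
    refine le_of_mul_le_mul_right ?_ hX
    nlinarith [sq_nonneg (m y)]
  have h2 := hm.one_le_mul hN z
  have h3 := hm.one_le_mul hN w
  have h5 := mul_le_mul h2 h3 zero_le_one (by positivity)
  have hy := hm.pos hN y
  have hz := hm.pos hN z
  have hw := hm.pos hN w
  have hZ := japaneseBracket_pos z
  have hW := japaneseBracket_pos w
  refine (sq_le_sq₀ (hm.pos hN x).le (by positivity)).1 ?_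
  have e1 : (⟪z⟫ ^ (1 / 2 : ℝ)) ^ 2 = ⟪z⟫ := by
    rw [← Real.sqrt_eq_rpow, Real.sq_sqrt hZ.le]
  have e2 : (⟪w⟫ ^ (1 / 2 : ℝ)) ^ 2 = ⟪w⟫ := by
    rw [← Real.sqrt_eq_rpow, Real.sq_sqrt hW.le]
  rw [mul_pow, mul_pow _ _ 2, mul_pow (⟪z⟫ ^ (1 / 2 : ℝ)), e1, e2]
  nlinarith [sq_nonneg (m y)]

theorem IsIMultiplier.le_of_le_japaneseBracket {N C₀ : ℝ} (hN : 1 ≤ N) {m : ℝ → ℝ}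
    (hm : IsIMultiplier N C₀ m) {x y z w : ℝ} (h : ⟪x⟫ ≤ ⟪y⟫) :
    m x ≤ 8 * (m y * m z * m w) *
      ((⟪y⟫ * ⟪z⟫ * ⟪w⟫) ^ (1 / 2 : ℝ) * ⟪x⟫ ^ (-(1 / 2) : ℝ)) := by
  have hX := japaneseBracket_pos x
  have h1 : m x ^ 2 * ⟪x⟫ ≤ 4 * ⟪y⟫ * m y ^ 2 := by
    have := hm.sq_mul_japaneseBracket_le hN x y
    rwa [max_eq_right h] at this
  have h2 := hm.one_le_mul hN z
  have h3 := hm.one_le_mul hN w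
  have h5 := mul_le_mul h2 h3 zero_le_one (by positivity)
  have hy := hm.pos hN y
  have hz := hm.pos hN z
  have hw := hm.pos hN w
  have hY := japaneseBracket_pos y
  have hZ := japaneseBracket_pos z
  have hW := japaneseBracket_pos w
  refine (sq_le_sq₀ (hm.pos hN x).le (by positivity)).1 ?_
  have e1 : ((⟪y⟫ * ⟪z⟫ * ⟪w⟫) ^ (1 / 2 : ℝ)) ^ 2 = ⟪y⟫ * ⟪z⟫ * ⟪w⟫ := by
    rw [← Real.sqrt_eq_rpow, Real.sq_sqrt (by positivity)]
  have e2 : (⟪x⟫ ^ (-(1 / 2) : ℝ)) ^ 2 = ⟪x⟫⁻¹ := by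
    rw [Real.rpow_neg hX.le, inv_pow, ← Real.sqrt_eq_rpow, Real.sq_sqrt hX.le]
  rw [mul_pow, mul_pow _ _ 2, mul_pow (_ ^ (1 / 2 : ℝ)), e1, e2, ← mul_assoc,
    ← div_eq_mul_inv, le_div_iff₀ hX]
  have h6 : 0 ≤ 4 * ⟪y⟫ * m y ^ 2 := by positivity
  nlinarith

theorem resonance_lower_bound {x y z : ℝ} (hy : 4 * ⟪x + y + z⟫ < ⟪x⟫)
    (hy' : 4 * ⟪x + y + z⟫ < ⟪y⟫) (hy'' : 4 * ⟪x + y + z⟫ < ⟪z⟫) :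
    2 / 5 * (⟪x⟫ * ⟪z⟫ * (⟪x⟫ ^ 2 + ⟪y⟫ ^ 2 + ⟪z⟫ ^ 2)) ≤
      |(x + y + z) ^ 4 - x ^ 4 + y ^ 4 - z ^ 4| := by
  have hX := one_le_japaneseBracket (x + y + z)
  have habs := abs_le_japaneseBracket (x + y + z)
  have key : ∀ t, 4 * ⟪x + y + z⟫ < ⟪t⟫ → 15 / 16 * ⟪t⟫ ^ 2 ≤ t ^ 2 ∧
      7 / 10 * ⟪t⟫ ≤ |x + y + z - t| := by
    intro t ht
    have h1 : 15 / 16 * ⟪t⟫ ^ 2 ≤ t ^ 2 := by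
      have := japaneseBracket_sq t
      nlinarith
    have h2 : 19 / 20 * ⟪t⟫ ≤ |t| := by
      refine (sq_le_sq₀ (by linarith) (abs_nonneg t)).1 ?_
      rw [sq_abs]
      nlinarith [sq_nonneg ⟪t⟫]
    refine ⟨h1, ?_⟩
    have h3 : |t| ≤ |x + y + z| + |x + y + z - t| := by
      have := abs_sub (x + y + z) (x + y + z - t)
      rwa [sub_sub_cancel] at this
    linarith
  obtain ⟨a1, a2⟩ := key x hy
  obtain ⟨b1, -⟩ := key y hy'
  obtain ⟨c1, c2⟩ := key z hy''
  have hfac : (x + y + z) ^ 4 - x ^ 4 + y ^ 4 - z ^ 4 = (x + y + z - x) * (x + y + z - z) *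
      (x ^ 2 + y ^ 2 + z ^ 2 + (x + y + z) ^ 2 + 2 * (x + z) ^ 2) := by ring
  rw [hfac, abs_mul, abs_mul]
  have h4 : 15 / 16 * (⟪x⟫ ^ 2 + ⟪y⟫ ^ 2 + ⟪z⟫ ^ 2) ≤
      |x ^ 2 + y ^ 2 + z ^ 2 + (x + y + z) ^ 2 + 2 * (x + z) ^ 2| := by
    refine le_trans ?_ (le_abs_self _)
    nlinarith [sq_nonneg (x + y + z), sq_nonneg (x + z)]
  have hx0 := japaneseBracket_pos x
  have hz0 := japaneseBracket_pos z
  calc _ ≤ 7 / 10 * ⟪x⟫ * (7 / 10 * ⟪z⟫) * (15 / 16 * (⟪x⟫ ^ 2 + ⟪y⟫ ^ 2 + ⟪z⟫ ^ 2)) := by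
        have : 0 ≤ ⟪x⟫ * ⟪z⟫ * (⟪x⟫ ^ 2 + ⟪y⟫ ^ 2 + ⟪z⟫ ^ 2) := by positivity
        linarith
    _ ≤ _ := by gcongr

theorem rpow_neg_mul_le {b X J Q t : ℝ} (hb1 : 1 / 2 < b) (hb2 : b ≤ 5 / 6) (hX : 1 ≤ X)
    (hXJ : X ≤ J) (hQ : 1 ≤ Q) (ht : Q * J / 10 ≤ t) :
    t ^ (-b) * (Q ^ (1 / 2 : ℝ) * X ^ (-(1 / 2) : ℝ)) ≤
      10 * (X ^ (-(1 / 4 + b / 2)) * J ^ (-(1 / 4 + b / 2))) := by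
  have hX0 : 0 < X := by linarith
  have hJ0 : 0 < J := by linarith
  have hQ0 : 0 < Q := by linarith
  have h1 : t ^ (-b) ≤ (Q * J / 10) ^ (-b) :=
    Real.rpow_le_rpow_of_nonpos (by positivity) ht (by linarith)
  have h2 : (Q * J / 10) ^ (-b) = 10 ^ b * (Q ^ (-b) * J ^ (-b)) := by
    rw [Real.div_rpow (by positivity) (by norm_num), Real.mul_rpow hQ0.le hJ0.le,
      Real.rpow_neg (x := 10) (by norm_num), div_inv_eq_mul, mul_comm]
  have h3 : (10 : ℝ) ^ b ≤ 10 := by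
    conv_rhs => rw [← Real.rpow_one 10]
    exact Real.rpow_le_rpow_of_exponent_le (by norm_num) (by linarith)
  have h4 : Q ^ (-b) ≤ Q ^ (-(1 / 2) : ℝ) := Real.rpow_le_rpow_of_exponent_le hQ (by linarith)
  have h5 : Q ^ (-(1 / 2) : ℝ) * Q ^ (1 / 2 : ℝ) = 1 := by
    rw [← Real.rpow_add hQ0]
    norm_num
  have h6 : J ^ (-b) * X ^ (-(1 / 2) : ℝ) ≤ X ^ (-(1 / 4 + b / 2)) * J ^ (-(1 / 4 + b / 2)) := by
    have e1 : X ^ (-(1 / 2) : ℝ) = X ^ (-(1 / 4 + b / 2)) * X ^ (b / 2 - 1 / 4) := by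
      rw [← Real.rpow_add hX0]
      ring_nf
    have e2 : J ^ (-(1 / 4 + b / 2)) = J ^ (-b) * J ^ (b / 2 - 1 / 4) := by
      rw [← Real.rpow_add hJ0]
      ring_nf
    have e3 : X ^ (b / 2 - 1 / 4) ≤ J ^ (b / 2 - 1 / 4) :=
      Real.rpow_le_rpow hX0.le hXJ (by linarith)
    rw [e1, e2]
    calc _ = X ^ (-(1 / 4 + b / 2)) * (J ^ (-b) * X ^ (b / 2 - 1 / 4)) := by ring
      _ ≤ _ := by gcongr
  calc _ ≤ 10 * (Q ^ (-(1 / 2) : ℝ) * J ^ (-b)) * (Q ^ (1 / 2 : ℝ) * X ^ (-(1 / 2) : ℝ)) := by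
        refine mul_le_mul_of_nonneg_right (h1.trans ?_) (by positivity)
        rw [h2]
        gcongr
    _ = 10 * (J ^ (-b) * X ^ (-(1 / 2) : ℝ)) * (Q ^ (-(1 / 2) : ℝ) * Q ^ (1 / 2 : ℝ)) := by ring
    _ ≤ _ := by
        rw [h5, mul_one]
        gcongr

theorem rpow_sub_one_mul_le {b Q t : ℝ} (hb2 : b ≤ 5 / 6) (hQ : 10 ≤ Q)
    (ht : Q / 10 ≤ t) : t ^ (b - 1) * Q ^ (1 / 2 : ℝ) ≤ 10 * Q ^ (1 / 3 : ℝ) := by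
  have hQ0 : 0 < Q := by linarith
  have h1 : t ^ (b - 1) ≤ (Q / 10) ^ (b - 1) :=
    Real.rpow_le_rpow_of_nonpos (by positivity) ht (by linarith)
  have h2 : (Q / 10) ^ (b - 1) ≤ (Q / 10) ^ (-(1 / 6) : ℝ) :=
    Real.rpow_le_rpow_of_exponent_le (by linarith) (by linarith)
  have h3 : (Q / 10) ^ (-(1 / 6) : ℝ) = 10 ^ (1 / 6 : ℝ) * Q ^ (-(1 / 6) : ℝ) := by
    rw [Real.div_rpow hQ0.le (by norm_num), Real.rpow_neg (x := 10) (by norm_num), div_inv_eq_mul,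
      mul_comm]
  have h4 : (10 : ℝ) ^ (1 / 6 : ℝ) ≤ 10 := by
    conv_rhs => rw [← Real.rpow_one 10]
    exact Real.rpow_le_rpow_of_exponent_le (by norm_num) (by norm_num)
  have h5 : Q ^ (-(1 / 6) : ℝ) * Q ^ (1 / 2 : ℝ) = Q ^ (1 / 3 : ℝ) := by
    rw [← Real.rpow_add hQ0]
    norm_num
  calc _ ≤ 10 * Q ^ (-(1 / 6) : ℝ) * Q ^ (1 / 2 : ℝ) := by
        refine mul_le_mul_of_nonneg_right ((h1.trans h2).trans ?_) (by positivity)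
        rw [h3]
        gcongr
    _ = _ := by rw [mul_assoc, h5]

theorem IsIMultiplier.kernel_cases {N C₀ b : ℝ} (hb1 : 1 / 2 < b) (hb2 : b ≤ 5 / 6) (hN : 1 ≤ N)
    {m : ℝ → ℝ} (hm : IsIMultiplier N C₀ m) {x y z s s₁ s₂ s₃ : ℝ}
    (hs : s - s₁ - s₂ - s₃ = (x + y + z) ^ 4 - x ^ 4 + y ^ 4 - z ^ 4) :
    m (x + y + z) * ⟪s⟫ ^ (b - 1) ≤ 100 * (m x * m y * m z) *
        (⟪x⟫ ^ (1 / 2 : ℝ) * ⟪y⟫ ^ (1 / 2 : ℝ) + ⟪x⟫ ^ (1 / 2 : ℝ) * ⟪z⟫ ^ (1 / 2 : ℝ) +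
          ⟪y⟫ ^ (1 / 2 : ℝ) * ⟪z⟫ ^ (1 / 2 : ℝ) +
          ⟪x⟫ ^ (1 / 3 : ℝ) * ⟪y⟫ ^ (1 / 3 : ℝ) * ⟪z⟫ ^ (1 / 3 : ℝ)) ∨
      m (x + y + z) * ⟪s₁⟫ ^ (-b) ≤ 100 * (m x * m y * m z) *
        (⟪x + y + z⟫ ^ (-(1 / 4 + b / 2)) * ⟪y⟫ ^ (-(1 / 4 + b / 2))) ∨
      m (x + y + z) * ⟪s₂⟫ ^ (-b) ≤ 100 * (m x * m y * m z) *
        (⟪x + y + z⟫ ^ (-(1 / 4 + b / 2)) * ⟪x⟫ ^ (-(1 / 4 + b / 2))) ∨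
      m (x + y + z) * ⟪s₃⟫ ^ (-b) ≤ 100 * (m x * m y * m z) *
        (⟪x + y + z⟫ ^ (-(1 / 4 + b / 2)) * ⟪x⟫ ^ (-(1 / 4 + b / 2))) := by
  have hX := japaneseBracket_pos x
  have hY := japaneseBracket_pos y
  have hZ := japaneseBracket_pos z
  have hM : 0 < m x * m y * m z := mul_pos (mul_pos (hm.pos hN x) (hm.pos hN y)) (hm.pos hN z)
  by_cases c : ⟪x⟫ ≤ 4 * ⟪x + y + z⟫ ∨ ⟪y⟫ ≤ 4 * ⟪x + y + z⟫ ∨ ⟪z⟫ ≤ 4 * ⟪x + y + z⟫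
  · left
    have hσ : ⟪s⟫ ^ (b - 1) ≤ 1 :=
      Real.rpow_le_one_of_one_le_of_nonpos (one_le_japaneseBracket s) (by linarith)
    refine (mul_le_of_le_one_right (hm.2.2.1 _).1 hσ).trans ?_
    have q1 : 0 ≤ ⟪x⟫ ^ (1 / 2 : ℝ) * ⟪y⟫ ^ (1 / 2 : ℝ) := by positivity
    have q2 : 0 ≤ ⟪x⟫ ^ (1 / 2 : ℝ) * ⟪z⟫ ^ (1 / 2 : ℝ) := by positivity
    have q3 : 0 ≤ ⟪y⟫ ^ (1 / 2 : ℝ) * ⟪z⟫ ^ (1 / 2 : ℝ) := by positivity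
    have q4 : 0 ≤ ⟪x⟫ ^ (1 / 3 : ℝ) * ⟪y⟫ ^ (1 / 3 : ℝ) * ⟪z⟫ ^ (1 / 3 : ℝ) := by positivity
    rcases c with c | c | c
    · refine (hm.le_of_japaneseBracket_le hN (z := y) (w := z) c).trans ?_
      gcongr
      · norm_num
      · linarith
    · refine (hm.le_of_japaneseBracket_le hN (z := x) (w := z) c).trans ?_
      rw [mul_comm (m y)]
      gcongr
      · norm_num
      · linarith
    · refine (hm.le_of_japaneseBracket_le hN (z := x) (w := y) c).trans ?_
      rw [mul_assoc (m z), mul_comm (m z)]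
      gcongr
      · norm_num
      · linarith
  push Not at c
  obtain ⟨cx, cy, cz⟩ := c
  have X1 := one_le_japaneseBracket x
  have Y1 := one_le_japaneseBracket y
  have Z1 := one_le_japaneseBracket z
  have W1 := one_le_japaneseBracket (x + y + z)
  have hmW := hm.le_of_le_japaneseBracket hN (y := x) (z := y) (w := z) (x := x + y + z)
    (by linarith)
  have hQ10 : 10 ≤ ⟪x⟫ * ⟪y⟫ * ⟪z⟫ := by
    have h1 : 16 ≤ ⟪x⟫ * ⟪y⟫ := by nlinarith
    nlinarith
  have hQ0 : 0 < ⟪x⟫ * ⟪y⟫ * ⟪z⟫ := by positivity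
  have gain : ∀ t J, ⟪x + y + z⟫ ≤ J → ⟪x⟫ * ⟪y⟫ * ⟪z⟫ * J / 10 ≤ ⟪t⟫ →
      m (x + y + z) * ⟪t⟫ ^ (-b) ≤ 100 * (m x * m y * m z) *
        (⟪x + y + z⟫ ^ (-(1 / 4 + b / 2)) * J ^ (-(1 / 4 + b / 2))) := by
    intro t J hJ ht
    have h1 := rpow_neg_mul_le hb1 hb2 W1 hJ (by linarith) ht
    have hJ0 : 0 < J := by linarith
    have ht0 := Real.rpow_nonneg (japaneseBracket_pos t).le (-b)
    have hW0 := japaneseBracket_pos (x + y + z)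
    refine (mul_le_mul_of_nonneg_right hmW ht0).trans ?_
    rw [mul_assoc, mul_comm _ (⟪t⟫ ^ (-b))]
    refine (mul_le_mul_of_nonneg_left h1 (by positivity)).trans ?_
    have : 0 ≤ m x * m y * m z *
      (⟪x + y + z⟫ ^ (-(1 / 4 + b / 2)) * J ^ (-(1 / 4 + b / 2))) := by positivity
    linarith
  by_cases c1 : ⟪x⟫ * ⟪y⟫ * ⟪z⟫ * ⟪y⟫ / 10 ≤ ⟪s₁⟫
  · exact Or.inr (Or.inl (gain s₁ ⟪y⟫ (by linarith) c1))
  by_cases c2 : ⟪x⟫ * ⟪y⟫ * ⟪z⟫ * ⟪x⟫ / 10 ≤ ⟪s₂⟫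
  · exact Or.inr (Or.inr (Or.inl (gain s₂ ⟪x⟫ (by linarith) c2)))
  by_cases c3 : ⟪x⟫ * ⟪y⟫ * ⟪z⟫ * ⟪x⟫ / 10 ≤ ⟪s₃⟫
  · exact Or.inr (Or.inr (Or.inr (gain s₃ ⟪x⟫ (by linarith) c3)))
  have c0 : ⟪x⟫ * ⟪y⟫ * ⟪z⟫ / 10 ≤ ⟪s⟫ := by
    have hres := resonance_lower_bound cx cy cz
    rw [← hs] at hres
    have hsum : |s - s₁ - s₂ - s₃| ≤ ⟪s⟫ + ⟪s₁⟫ + ⟪s₂⟫ + ⟪s₃⟫ := by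
      have h1 := abs_sub (s - s₁ - s₂) s₃
      have h2 := abs_sub (s - s₁) s₂
      have h3 := abs_sub s s₁
      linarith [abs_le_japaneseBracket s, abs_le_japaneseBracket s₁, abs_le_japaneseBracket s₂,
        abs_le_japaneseBracket s₃]
    have hXZ := (mul_pos hX hZ).le
    have hQx : ⟪x⟫ * ⟪y⟫ * ⟪z⟫ * ⟪x⟫ ≤ ⟪x⟫ * ⟪z⟫ * (⟪x⟫ ^ 2 + ⟪y⟫ ^ 2 + ⟪z⟫ ^ 2) := by
      have : 0 ≤ ⟪x⟫ ^ 2 + ⟪y⟫ ^ 2 + ⟪z⟫ ^ 2 - ⟪x⟫ * ⟪y⟫ := by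
        nlinarith [sq_nonneg (⟪x⟫ - ⟪y⟫), sq_nonneg ⟪z⟫, sq_nonneg ⟪x⟫, sq_nonneg ⟪y⟫]
      linarith [mul_nonneg hXZ this]
    have hQy : ⟪x⟫ * ⟪y⟫ * ⟪z⟫ * ⟪y⟫ ≤ ⟪x⟫ * ⟪z⟫ * (⟪x⟫ ^ 2 + ⟪y⟫ ^ 2 + ⟪z⟫ ^ 2) := by
      have : 0 ≤ ⟪x⟫ ^ 2 + ⟪z⟫ ^ 2 := by positivity
      linarith [mul_nonneg hXZ this]
    have : ⟪x⟫ * ⟪y⟫ * ⟪z⟫ ≤ ⟪x⟫ * ⟪y⟫ * ⟪z⟫ * ⟪x⟫ := le_mul_of_one_le_right hQ0.le X1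
    linarith
  left
  have hσ0 := Real.rpow_nonneg (japaneseBracket_pos s).le (b - 1)
  have h2 : ⟪x + y + z⟫ ^ (-(1 / 2) : ℝ) ≤ 1 :=
    Real.rpow_le_one_of_one_le_of_nonpos W1 (by norm_num)
  have hQ2 : 0 ≤ (⟪x⟫ * ⟪y⟫ * ⟪z⟫) ^ (1 / 2 : ℝ) := by positivity
  have h3 : m (x + y + z) ≤ 8 * (m x * m y * m z) * (⟪x⟫ * ⟪y⟫ * ⟪z⟫) ^ (1 / 2 : ℝ) :=
    hmW.trans (mul_le_mul_of_nonneg_left (mul_le_of_le_one_right hQ2 h2) (by positivity))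
  refine (mul_le_mul_of_nonneg_right h3 hσ0).trans ?_
  rw [mul_assoc, mul_comm _ (⟪s⟫ ^ (b - 1))]
  refine (mul_le_mul_of_nonneg_left (rpow_sub_one_mul_le hb2 hQ10 c0) (by positivity)).trans ?_
  rw [Real.mul_rpow (by positivity) hZ.le, Real.mul_rpow hX.le hY.le]
  have q4 : 0 ≤ m x * m y * m z *
    (⟪x⟫ ^ (1 / 3 : ℝ) * ⟪y⟫ ^ (1 / 3 : ℝ) * ⟪z⟫ ^ (1 / 3 : ℝ)) := by positivity
  have q5 : 0 ≤ m x * m y * m z *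
    (⟪x⟫ ^ (1 / 2 : ℝ) * ⟪y⟫ ^ (1 / 2 : ℝ) + ⟪x⟫ ^ (1 / 2 : ℝ) * ⟪z⟫ ^ (1 / 2 : ℝ) +
          ⟪y⟫ ^ (1 / 2 : ℝ) * ⟪z⟫ ^ (1 / 2 : ℝ)) := by positivity
  linarith

theorem IsIMultiplier.kernel_le {N C₀ b : ℝ} (hb1 : 1 / 2 < b) (hb2 : b ≤ 5 / 6) (hN : 1 ≤ N)
    {m : ℝ → ℝ} (hm : IsIMultiplier N C₀ m) {x y z s s₁ s₂ s₃ : ℝ}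
    (hs : s - s₁ - s₂ - s₃ = (x + y + z) ^ 4 - x ^ 4 + y ^ 4 - z ^ 4) :
    m (x + y + z) * ⟪s⟫ ^ (b - 1) * (⟪s₁⟫ ^ (-b) * ⟪s₂⟫ ^ (-b) * ⟪s₃⟫ ^ (-b)) ≤
      100 * (m x * m y * m z) *
        ((⟪x⟫ ^ (1 / 2 : ℝ) * ⟪y⟫ ^ (1 / 2 : ℝ) + ⟪x⟫ ^ (1 / 2 : ℝ) * ⟪z⟫ ^ (1 / 2 : ℝ) +
          ⟪y⟫ ^ (1 / 2 : ℝ) * ⟪z⟫ ^ (1 / 2 : ℝ) +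
          ⟪x⟫ ^ (1 / 3 : ℝ) * ⟪y⟫ ^ (1 / 3 : ℝ) * ⟪z⟫ ^ (1 / 3 : ℝ)) *
            (⟪s₁⟫ ^ (-b) * ⟪s₂⟫ ^ (-b) * ⟪s₃⟫ ^ (-b)) +
        ⟪x + y + z⟫ ^ (-(1 / 4 + b / 2)) * ⟪y⟫ ^ (-(1 / 4 + b / 2)) *
          (⟪s₂⟫ ^ (-b) * ⟪s₃⟫ ^ (-b)) +
        ⟪x + y + z⟫ ^ (-(1 / 4 + b / 2)) * ⟪x⟫ ^ (-(1 / 4 + b / 2)) *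
          (⟪s₁⟫ ^ (-b) * ⟪s₃⟫ ^ (-b)) +
        ⟪x + y + z⟫ ^ (-(1 / 4 + b / 2)) * ⟪x⟫ ^ (-(1 / 4 + b / 2)) *
          (⟪s₁⟫ ^ (-b) * ⟪s₂⟫ ^ (-b))) := by
  have hS := Real.rpow_pos_of_pos (japaneseBracket_pos s) (b - 1)
  have hσ : ⟪s⟫ ^ (b - 1) ≤ 1 :=
    Real.rpow_le_one_of_one_le_of_nonpos (one_le_japaneseBracket s) (by linarith)
  have hS1 := Real.rpow_pos_of_pos (japaneseBracket_pos s₁) (-b)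
  have hS2 := Real.rpow_pos_of_pos (japaneseBracket_pos s₂) (-b)
  have hS3 := Real.rpow_pos_of_pos (japaneseBracket_pos s₃) (-b)
  have hM : 0 < m x * m y * m z := mul_pos (mul_pos (hm.pos hN x) (hm.pos hN y)) (hm.pos hN z)
  have hX := japaneseBracket_pos x
  have hY := japaneseBracket_pos y
  have hZ := japaneseBracket_pos z
  have hW := japaneseBracket_pos (x + y + z)
  have hm0 : 0 ≤ m (x + y + z) := (hm.2.2.1 _).1
  have pA : 0 ≤ ⟪x⟫ ^ (1 / 2 : ℝ) * ⟪y⟫ ^ (1 / 2 : ℝ) + ⟪x⟫ ^ (1 / 2 : ℝ) * ⟪z⟫ ^ (1 / 2 : ℝ) +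
      ⟪y⟫ ^ (1 / 2 : ℝ) * ⟪z⟫ ^ (1 / 2 : ℝ) +
      ⟪x⟫ ^ (1 / 3 : ℝ) * ⟪y⟫ ^ (1 / 3 : ℝ) * ⟪z⟫ ^ (1 / 3 : ℝ) := by positivity
  have pB : 0 ≤ ⟪x + y + z⟫ ^ (-(1 / 4 + b / 2)) * ⟪y⟫ ^ (-(1 / 4 + b / 2)) := by positivity
  have pC : 0 ≤ ⟪x + y + z⟫ ^ (-(1 / 4 + b / 2)) * ⟪x⟫ ^ (-(1 / 4 + b / 2)) := by positivity
  have cases := hm.kernel_cases hb1 hb2 hN hs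
  generalize ⟪s₁⟫ ^ (-b) = S₁ at *
  generalize ⟪s₂⟫ ^ (-b) = S₂ at *
  generalize ⟪s₃⟫ ^ (-b) = S₃ at *
  generalize ⟪s⟫ ^ (b - 1) = S at *
  generalize m (x + y + z) = μ at *
  generalize m x * m y * m z = M at *
  generalize ⟪x⟫ ^ (1 / 2 : ℝ) * ⟪y⟫ ^ (1 / 2 : ℝ) + ⟪x⟫ ^ (1 / 2 : ℝ) * ⟪z⟫ ^ (1 / 2 : ℝ) +
      ⟪y⟫ ^ (1 / 2 : ℝ) * ⟪z⟫ ^ (1 / 2 : ℝ) +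
      ⟪x⟫ ^ (1 / 3 : ℝ) * ⟪y⟫ ^ (1 / 3 : ℝ) * ⟪z⟫ ^ (1 / 3 : ℝ) = A at *
  generalize ⟪x + y + z⟫ ^ (-(1 / 4 + b / 2)) * ⟪y⟫ ^ (-(1 / 4 + b / 2)) = B at *
  generalize ⟪x + y + z⟫ ^ (-(1 / 4 + b / 2)) * ⟪x⟫ ^ (-(1 / 4 + b / 2)) = D at *
  have tA : 0 ≤ M * (A * (S₁ * S₂ * S₃)) := by positivity
  have tB : 0 ≤ M * (B * (S₂ * S₃)) := by positivity
  have tD : 0 ≤ M * (D * (S₁ * S₃)) := by positivity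
  have tE : 0 ≤ M * (D * (S₁ * S₂)) := by positivity
  have hdrop : μ * S * (S₁ * S₂ * S₃) ≤ μ * (S₁ * S₂ * S₃) :=
    mul_le_mul_of_nonneg_right (mul_le_of_le_one_right hm0 hσ) (by positivity)
  rcases cases with h | h | h | h
  · linarith [mul_le_mul_of_nonneg_right h (show 0 ≤ S₁ * S₂ * S₃ by positivity)]
  · linarith [mul_le_mul_of_nonneg_right h (show 0 ≤ S₂ * S₃ by positivity)]
  · linarith [mul_le_mul_of_nonneg_right h (show 0 ≤ S₁ * S₃ by positivity)]
  · linarith [mul_le_mul_of_nonneg_right h (show 0 ≤ S₁ * S₂ by positivity)]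

section Convolution

variable {α : Type*} [MeasurableSpace α] {μ : Measure α}

theorem ENNReal.rpow_half_sq (a : ℝ≥0∞) : (a ^ (1 / 2 : ℝ)) ^ 2 = a := by
  rw [← ENNReal.rpow_natCast, ← ENNReal.rpow_mul]
  norm_num

theorem lintegral_mul_sq_le {f g : α → ℝ≥0∞} (hf : Measurable f) (hg : Measurable g) :
    (∫⁻ x, f x * g x ∂μ) ^ 2 ≤ (∫⁻ x, f x ^ 2 ∂μ) * ∫⁻ x, g x ^ 2 ∂μ := by
  have h := ENNReal.lintegral_mul_le_Lp_mul_Lq μ Real.HolderConjugate.two_two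
    hf.aemeasurable hg.aemeasurable
  simp only [Pi.mul_apply, ENNReal.rpow_two] at h
  refine (pow_le_pow_left₀ zero_le h 2).trans_eq ?_
  rw [mul_pow, ENNReal.rpow_half_sq, ENNReal.rpow_half_sq]

theorem lintegral_mul_sq_le' {f g : α → ℝ≥0∞} (hf : Measurable f) (hg : Measurable g) :
    (∫⁻ x, f x * g x ∂μ) ^ 2 ≤ (∫⁻ x, f x ∂μ) * ∫⁻ x, f x * g x ^ 2 ∂μ := by
  have h := lintegral_mul_sq_le (μ := μ) (hf.pow_const (1 / 2 : ℝ))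
    ((hf.pow_const (1 / 2 : ℝ)).mul hg)
  simp only [Pi.mul_apply, mul_pow, ENNReal.rpow_half_sq] at h
  refine le_trans (le_of_eq ?_) h
  congr 2 with x
  rw [← mul_assoc, ← sq, ENNReal.rpow_half_sq]

variable {G : Type*} [AddCommGroup G] [MeasurableSpace G] {ν : Measure G}

theorem lconvolution_mono {f f' g g' : G → ℝ≥0∞} (hf : ∀ x, f x ≤ f' x) (hg : ∀ x, g x ≤ g' x)
    (x : G) : (f ⋆ₗ[ν] g) x ≤ (f' ⋆ₗ[ν] g') x :=
  lintegral_mono fun _ => mul_le_mul' (hf _) (hg _)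

variable [MeasurableAdd₂ G] [MeasurableNeg G]

theorem lconvolution_mul_sq_le {f₁ f₂ w₁ w₂ : G → ℝ≥0∞} (hf₁ : Measurable f₁)
    (hf₂ : Measurable f₂) (hw₁ : Measurable w₁) (hw₂ : Measurable w₂) (x : G) :
    ((fun y => w₁ y * f₁ y) ⋆ₗ[ν] fun y => w₂ y * f₂ y) x ^ 2 ≤
      ((fun y => w₁ y ^ 2) ⋆ₗ[ν] fun y => w₂ y ^ 2) x *
        ((fun y => f₁ y ^ 2) ⋆ₗ[ν] fun y => f₂ y ^ 2) x := by
  have h := lintegral_mul_sq_le (μ := ν) (f := fun y => w₁ y * w₂ (-y + x))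
    (g := fun y => f₁ y * f₂ (-y + x)) (by fun_prop) (by fun_prop)
  simp only [mul_pow] at h
  refine le_trans (le_of_eq ?_) h
  rw [lconvolution_def]
  congr 2 with y
  ring

variable [SFinite ν]

theorem lconvolution_lconvolution_mul_sq_le {f₁ f₂ f₃ w₁ w₂ w₃ : G → ℝ≥0∞} (hf₁ : Measurable f₁)
    (hf₂ : Measurable f₂) (hf₃ : Measurable f₃) (hw₁ : Measurable w₁) (hw₂ : Measurable w₂)
    (hw₃ : Measurable w₃) (x : G) :
    ((fun y => w₁ y * f₁ y) ⋆ₗ[ν] (fun y => w₂ y * f₂ y) ⋆ₗ[ν] fun y => w₃ y * f₃ y) x ^ 2 ≤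
      ((fun y => w₁ y ^ 2) ⋆ₗ[ν] (fun y => w₂ y ^ 2) ⋆ₗ[ν] fun y => w₃ y ^ 2) x *
        ((fun y => f₁ y ^ 2) ⋆ₗ[ν] (fun y => f₂ y ^ 2) ⋆ₗ[ν] fun y => f₃ y ^ 2) x := by
  have hP := measurable_lconvolution ν (hw₂.pow_const 2) (hw₃.pow_const 2)
  have hR := measurable_lconvolution ν (hf₂.pow_const 2) (hf₃.pow_const 2)
  have h := lconvolution_mul_sq_le (ν := ν) hf₁ (hR.pow_const (1 / 2 : ℝ)) hw₁
    (hP.pow_const (1 / 2 : ℝ)) x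
  simp only [ENNReal.rpow_half_sq] at h
  refine le_trans (pow_le_pow_left₀ zero_le (lconvolution_mono (fun _ => le_rfl) ?_ x) 2) h
  intro y
  refine (ENNReal.pow_le_pow_left_iff two_ne_zero).1 ?_
  rw [mul_pow, ENNReal.rpow_half_sq, ENNReal.rpow_half_sq]
  exact lconvolution_mul_sq_le hf₂ hf₃ hw₂ hw₃ y

theorem lintegral_lconvolution_sq_eq [ν.IsNegInvariant] {f g : G → ℝ≥0∞} (hf : Measurable f)
    (hg : Measurable g) :
    ∫⁻ x, (f ⋆ₗ[ν] g) x ^ 2 ∂ν =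
      ∫⁻ y, ∫⁻ z, f y * f z * ∫⁻ x, g (x - y) * g (x - z) ∂ν ∂ν ∂ν := by
  have hsub : Measurable fun p : G × G => p.1 - p.2 := by
    simp only [sub_eq_add_neg]
    fun_prop
  have hg2 : Measurable fun p : G × G => g (p.1 - p.2) := hg.comp hsub
  have h : ∀ x, (f ⋆ₗ[ν] g) x ^ 2 =
      ∫⁻ y, ∫⁻ z, f y * f z * (g (x - y) * g (x - z)) ∂ν ∂ν := by
    intro x
    have hgx : Measurable fun y => f y * g (x - y) :=
      hf.mul (hg2.comp (measurable_const.prodMk measurable_id))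
    have e : (f ⋆ₗ[ν] g) x = ∫⁻ y, f y * g (x - y) ∂ν := by
      simp only [lconvolution_def, neg_add_eq_sub]
    rw [e, sq, ← lintegral_mul_const _ hgx]
    refine lintegral_congr fun y => ?_
    rw [← lintegral_const_mul _ hgx]
    refine lintegral_congr fun z => ?_
    ring
  have m3 : Measurable fun p : G × G × G => f p.2.1 * f p.2.2 *
      (g (p.1 - p.2.1) * g (p.1 - p.2.2)) := by
    have a1 : Measurable fun p : G × G × G => g (p.1 - p.2.1) :=
      hg2.comp (measurable_fst.prodMk (measurable_fst.comp measurable_snd))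
    have a2 : Measurable fun p : G × G × G => g (p.1 - p.2.2) :=
      hg2.comp (measurable_fst.prodMk (measurable_snd.comp measurable_snd))
    fun_prop
  simp only [h]
  rw [lintegral_lintegral_swap]
  · refine lintegral_congr fun y => ?_
    rw [lintegral_lintegral_swap]
    · refine lintegral_congr fun z => ?_
      rw [lintegral_const_mul]
      exact (hg2.comp (measurable_id.prodMk measurable_const)).mul
        (hg2.comp (measurable_id.prodMk measurable_const))
    · exact (m3.comp (f := fun p : G × G => (p.1, y, p.2)) (by fun_prop)).aemeasurable
  · have : Measurable fun q : (G × G) × G => f q.1.2 * f q.2 *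
      (g (q.1.1 - q.1.2) * g (q.1.1 - q.2)) :=
      m3.comp (f := fun q : (G × G) × G => (q.1.1, q.1.2, q.2)) (by fun_prop)
    exact this.lintegral_prod_right'.aemeasurable

variable [ν.IsAddLeftInvariant]

theorem lintegral_lconvolution {f g : G → ℝ≥0∞} (hf : Measurable f) (hg : Measurable g) :
    ∫⁻ x, (f ⋆ₗ[ν] g) x ∂ν = (∫⁻ x, f x ∂ν) * ∫⁻ x, g x ∂ν := by
  simp only [lconvolution_def]
  rw [lintegral_lintegral_swap (by fun_prop), ← lintegral_mul_const _ hf]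
  refine lintegral_congr fun y => ?_
  rw [lintegral_const_mul _ (by fun_prop), lintegral_add_left_eq_self g (-y)]

theorem lintegral_lconvolution_sq_le_of_le {f₁ f₂ f₃ w₁ w₂ w₃ : G → ℝ≥0∞} (hf₁ : Measurable f₁)
    (hf₂ : Measurable f₂) (hf₃ : Measurable f₃) (hw₁ : Measurable w₁) (hw₂ : Measurable w₂)
    (hw₃ : Measurable w₃) {K : ℝ≥0∞}
    (hK : ∀ x, ((fun y => w₁ y ^ 2) ⋆ₗ[ν] (fun y => w₂ y ^ 2) ⋆ₗ[ν] fun y => w₃ y ^ 2) x ≤ K) :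
    ∫⁻ x, ((fun y => w₁ y * f₁ y) ⋆ₗ[ν] (fun y => w₂ y * f₂ y) ⋆ₗ[ν] fun y => w₃ y * f₃ y) x ^ 2
        ∂ν ≤ K * ((∫⁻ x, f₁ x ^ 2 ∂ν) * ((∫⁻ x, f₂ x ^ 2 ∂ν) * ∫⁻ x, f₃ x ^ 2 ∂ν)) := by
  have h2 := measurable_lconvolution ν (hf₂.pow_const 2) (hf₃.pow_const 2)
  rw [← lintegral_lconvolution (hf₂.pow_const 2) (hf₃.pow_const 2),
    ← lintegral_lconvolution (hf₁.pow_const 2) h2,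
    ← lintegral_const_mul _ (measurable_lconvolution ν (hf₁.pow_const 2) h2)]
  exact lintegral_mono fun x => (lconvolution_lconvolution_mul_sq_le hf₁ hf₂ hf₃ hw₁ hw₂ hw₃
    x).trans (mul_le_mul' (hK x) le_rfl)

theorem lintegral_lconvolution_sq_le {f g : G → ℝ≥0∞} (hf : Measurable f) (hg : Measurable g) :
    ∫⁻ x, (f ⋆ₗ[ν] g) x ^ 2 ∂ν ≤ (∫⁻ x, f x ∂ν) ^ 2 * ∫⁻ x, g x ^ 2 ∂ν := by
  have h : ∀ x, (f ⋆ₗ[ν] g) x ^ 2 ≤ (∫⁻ x, f x ∂ν) * (f ⋆ₗ[ν] fun y => g y ^ 2) x := by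
    intro x
    exact lintegral_mul_sq_le' (g := fun y => g (-y + x)) hf (by fun_prop)
  refine (lintegral_mono h).trans_eq ?_
  rw [lintegral_const_mul _ (measurable_lconvolution ν hf (hg.pow_const 2)),
    lintegral_lconvolution hf (hg.pow_const 2), sq, mul_assoc]

/-- Reflecting one factor does not change the `L²` norm of a convolution. -/
theorem lintegral_lconvolution_neg_sq [ν.IsNegInvariant] {f g : G → ℝ≥0∞} (hf : Measurable f)
    (hg : Measurable g) :
    ∫⁻ x, (f ⋆ₗ[ν] fun y => g (-y)) x ^ 2 ∂ν = ∫⁻ x, (f ⋆ₗ[ν] g) x ^ 2 ∂ν := by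
  rw [lintegral_lconvolution_sq_eq hf hg,
    lintegral_lconvolution_sq_eq hf (g := fun y => g (-y)) (hg.comp measurable_neg)]
  refine lintegral_congr fun y => lintegral_congr fun z => ?_
  congr 1
  rw [← lintegral_sub_left_eq_self _ (y + z)]
  refine lintegral_congr fun x => ?_
  rw [mul_comm]
  congr 2 <;> abel

theorem lintegral_weight_mul_lconvolution_sq_le [ν.IsNegInvariant] {f g k : G → ℝ≥0∞}
    (hf : Measurable f) (hg : Measurable g) (hk : Measurable k) {ω : G → ℝ≥0∞} (hω : Measurable ω) {K : ℝ≥0∞}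
    (hK : ∀ y, ∫⁻ x, ω x ^ 2 * k (-y + x) ^ 2 ∂ν ≤ K) :
    ∫⁻ x, (ω x * (f ⋆ₗ[ν] fun y => k y * g y) x) ^ 2 ∂ν ≤
      K * (∫⁻ x, f x ^ 2 ∂ν) * ∫⁻ x, g x ^ 2 ∂ν := by
  have hf2 := hf.pow_const 2
  have hk2 := hk.pow_const 2
  have h : ∀ x, (f ⋆ₗ[ν] fun y => k y * g y) x ^ 2 ≤
      ((fun y => f y ^ 2) ⋆ₗ[ν] fun y => k y ^ 2) x * ∫⁻ x, g x ^ 2 ∂ν := by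
    intro x
    have h := lintegral_mul_sq_le (μ := ν) (f := fun y => f y * k (-y + x))
      (g := fun y => g (-y + x)) (by fun_prop) (by fun_prop)
    simp only [mul_pow] at h
    simp only [neg_add_eq_sub] at h
    rw [lintegral_sub_left_eq_self (fun y => g y ^ 2) x] at h
    refine le_trans (le_of_eq ?_) (h.trans_eq ?_)
    · simp only [lconvolution_def, neg_add_eq_sub, mul_assoc]
    · simp only [lconvolution_def, neg_add_eq_sub]
  calc _ ≤ ∫⁻ x, ω x ^ 2 * ((fun y => f y ^ 2) ⋆ₗ[ν] fun y => k y ^ 2) x *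
        (∫⁻ x, g x ^ 2 ∂ν) ∂ν := by
        refine lintegral_mono fun x => ?_
        rw [mul_pow, mul_assoc]
        exact mul_le_mul' le_rfl (h x)
    _ = (∫⁻ x, ω x ^ 2 * ((fun y => f y ^ 2) ⋆ₗ[ν] fun y => k y ^ 2) x ∂ν) *
        (∫⁻ x, g x ^ 2 ∂ν) :=
        lintegral_mul_const _ ((hω.pow_const 2).mul (measurable_lconvolution ν hf2 hk2))
    _ = (∫⁻ y, f y ^ 2 * ∫⁻ x, ω x ^ 2 * k (-y + x) ^ 2 ∂ν ∂ν) * (∫⁻ x, g x ^ 2 ∂ν) := by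
        congr 1
        have e : ∀ x, ω x ^ 2 * ((fun y => f y ^ 2) ⋆ₗ[ν] fun y => k y ^ 2) x =
            ∫⁻ y, f y ^ 2 * (ω x ^ 2 * k (-y + x) ^ 2) ∂ν := by
          intro x
          rw [lconvolution_def, ← lintegral_const_mul _ (by fun_prop)]
          refine lintegral_congr fun y => ?_
          ring
        simp only [e]
        rw [lintegral_lintegral_swap (by fun_prop)]
        refine lintegral_congr fun y => ?_
        rw [lintegral_const_mul _ (by fun_prop)]
    _ ≤ _ := by
        gcongr
        rw [mul_comm, ← lintegral_mul_const _ hf2]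
        exact lintegral_mono fun y => mul_le_mul' le_rfl (hK y)

end Convolution

theorem quartic_deriv_lower_bound {u v y r : ℝ} (h : u ^ 2 + v ^ 2 = 1) (hr : 0 ≤ r) :
    r * ((y + r * u) ^ 2 + (y + r * v) ^ 2 + (y + r * (-u - v)) ^ 2) ≤
      4 * (y + r * u) ^ 3 * u + 4 * (y + r * v) ^ 3 * v +
        4 * (y + r * (-u - v)) ^ 3 * (-u - v) := by
  set Q := 2 * (u ^ 2 + u * v + v ^ 2) with hQ
  have hQ1 : 1 ≤ Q := by nlinarith [sq_nonneg (u + v)]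
  have hS : 4 * (3 * u * v * (-u - v)) ^ 2 ≤ Q ^ 3 := by
    have e : Q ^ 3 = 2 * ((u - v) * (2 * u + v) * (u + 2 * v)) ^ 2 +
        54 * (u * v * (u + v)) ^ 2 := by
      rw [hQ]
      ring
    nlinarith [sq_nonneg ((u - v) * (2 * u + v) * (u + 2 * v)), sq_nonneg (u * v * (u + v))]
  have hmain : 0 ≤ 9 * y ^ 2 * Q + 12 * y * r * (3 * u * v * (-u - v)) + r ^ 2 * Q ^ 2 := by
    refine nonneg_of_mul_nonneg_right (a := Q) ?_ (by linarith)
    have e : Q * (9 * y ^ 2 * Q + 12 * y * r * (3 * u * v * (-u - v)) + r ^ 2 * Q ^ 2) =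
        (3 * y * Q + 2 * r * (3 * u * v * (-u - v))) ^ 2 +
          r ^ 2 * (Q ^ 3 - 4 * (3 * u * v * (-u - v)) ^ 2) := by ring
    rw [e]
    have := mul_nonneg (sq_nonneg r) (sub_nonneg.2 hS)
    positivity
  have e1 : (y + r * u) ^ 2 + (y + r * v) ^ 2 + (y + r * (-u - v)) ^ 2 = 3 * y ^ 2 + r ^ 2 * Q := by
    rw [hQ]
    ring
  have e2 : 4 * (y + r * u) ^ 3 * u + 4 * (y + r * v) ^ 3 * v +
        4 * (y + r * (-u - v)) ^ 3 * (-u - v) = r * (Q * (3 * y ^ 2 + r ^ 2 * Q)) +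
        r * (9 * y ^ 2 * Q + 12 * y * r * (3 * u * v * (-u - v)) + r ^ 2 * Q ^ 2) := by
    rw [hQ]
    ring
  rw [e1, e2]
  have h3 : 3 * y ^ 2 + r ^ 2 * Q ≤ Q * (3 * y ^ 2 + r ^ 2 * Q) :=
    le_mul_of_one_le_left (by positivity) hQ1
  have := mul_le_mul_of_nonneg_left h3 hr
  have := mul_nonneg hr hmain
  linarith

theorem lintegral_radial_le {u v : ℝ} (h : u ^ 2 + v ^ 2 = 1) (y t : ℝ) {Φ : ℝ → ℝ≥0∞}
    (hΦ : Measurable Φ) {M : ℝ≥0∞} (hM : ∀ s, Φ s ≤ M) :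
    ∫⁻ r in Set.Ioi (0 : ℝ), ENNReal.ofReal
      (r * (1 + (y + r * u) ^ 2 + (y + r * v) ^ 2 + (y + r * (-u - v)) ^ 2)) *
        Φ (t + (y + r * u) ^ 4 + (y + r * v) ^ 4 + (y + r * (-u - v)) ^ 4) ≤
      M + 2 * ∫⁻ s, Φ s := by
  set f : ℝ → ℝ := fun r => t + (y + r * u) ^ 4 + (y + r * v) ^ 4 + (y + r * (-u - v)) ^ 4 with hf
  set f' : ℝ → ℝ := fun r => 4 * (y + r * u) ^ 3 * u + 4 * (y + r * v) ^ 3 * v +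
        4 * (y + r * (-u - v)) ^ 3 * (-u - v) with hf'
  have hder : ∀ r, HasDerivAt f (f' r) r := by
    intro r
    have hlin : ∀ c : ℝ, HasDerivAt (fun r => (y + r * c) ^ 4) (4 * (y + r * c) ^ 3 * c) r := by
      intro c
      exact HasDerivAt.congr_deriv ((((hasDerivAt_id r).mul_const c).const_add y).pow 4)
        (by simp)
    exact (((hlin u).const_add t).add (hlin v)).add (hlin (-u - v))
  have hsq : ∀ r, r ^ 2 ≤ (y + r * u) ^ 2 + (y + r * v) ^ 2 + (y + r * (-u - v)) ^ 2 := by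
    intro r
    nlinarith [sq_nonneg y, sq_nonneg (r * (u + v))]
  have hlow : ∀ r, 0 ≤ r → r *
      ((y + r * u) ^ 2 + (y + r * v) ^ 2 + (y + r * (-u - v)) ^ 2) ≤ f' r := fun r hr =>
    quartic_deriv_lower_bound h hr
  have hpos : ∀ r, 0 < r → 0 < f' r := fun r hr =>
    (mul_pos hr (lt_of_lt_of_le (by positivity) (hsq r))).trans_le (hlow r hr.le)
  have hinj : Set.InjOn f (Set.Ioi 0) := by
    refine (strictMonoOn_of_deriv_pos (convex_Ioi 0)
      (fun r _ => (hder r).continuousAt.continuousWithinAt) fun r hr => ?_).injOn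
    rw [interior_Ioi] at hr
    rw [(hder r).deriv]
    exact hpos r hr
  have himg := lintegral_image_eq_lintegral_abs_deriv_mul measurableSet_Ioi
    (fun r _ => (hder r).hasDerivWithinAt) hinj Φ
  have hfm : Measurable f := by fun_prop
  have hfm' : Measurable f' := by fun_prop
  calc _ ≤ ∫⁻ r in Set.Ioi (0 : ℝ), ((Set.Iic (1 : ℝ)).indicator (fun _ => M) r +
        2 * (ENNReal.ofReal |f' r| * Φ (f r))) := by
        refine setLIntegral_mono ((measurable_const.indicator measurableSet_Iic).add (by fun_prop))
          fun r (hr : 0 < r) => ?_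
        rw [abs_of_pos (hpos r hr)]
        rcases le_or_gt r 1 with h1 | h1
        · rw [Set.indicator_of_mem (Set.mem_Iic.2 h1)]
          have hb : r * (1 + (y + r * u) ^ 2 + (y + r * v) ^ 2 + (y + r * (-u - v)) ^ 2) ≤
              1 + f' r := by linarith [hlow r hr.le]
          refine (mul_le_mul' (ENNReal.ofReal_le_ofReal hb) le_rfl).trans ?_
          rw [ENNReal.ofReal_add zero_le_one (hpos r hr).le, add_mul, ENNReal.ofReal_one, one_mul]
          refine add_le_add (hM _) ?_
          rw [two_mul]
          exact le_self_add
        · rw [Set.indicator_of_notMem (by simpa using h1), zero_add, ← mul_assoc,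
            ← ENNReal.ofReal_ofNat 2, ← ENNReal.ofReal_mul zero_le_two]
          refine mul_le_mul' (ENNReal.ofReal_le_ofReal ?_) le_rfl
          have h2 : 1 ≤ (y + r * u) ^ 2 + (y + r * v) ^ 2 + (y + r * (-u - v)) ^ 2 := by
            nlinarith [hsq r]
          nlinarith [hlow r hr.le]
    _ = M * volume (Set.Iic (1 : ℝ) ∩ Set.Ioi 0) + 2 * ∫⁻ s in f '' Set.Ioi 0, Φ s := by
        rw [himg, lintegral_add_left (measurable_const.indicator measurableSet_Iic),
          lintegral_const_mul _ (by fun_prop),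
          lintegral_indicator measurableSet_Iic, lintegral_const, Measure.restrict_apply_univ,
          Measure.restrict_apply measurableSet_Iic]
    _ ≤ _ := by
        rw [Set.inter_comm, Set.Ioi_inter_Iic, Real.volume_Ioc]
        simp only [sub_zero, ENNReal.ofReal_one, mul_one]
        gcongr
        exact Measure.restrict_le_self

theorem lintegral_quartic_level_le (y t : ℝ) {Φ : ℝ → ℝ≥0∞}
    (hΦ : Measurable Φ) {M : ℝ≥0∞} (hM : ∀ s, Φ s ≤ M) :
    ∫⁻ p : ℝ × ℝ, ENNReal.ofReal
      (1 + (y + p.1) ^ 2 + (y + p.2) ^ 2 + (y + (-p.1 - p.2)) ^ 2) *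
        Φ (t + (y + p.1) ^ 4 + (y + p.2) ^ 4 + (y + (-p.1 - p.2)) ^ 4) ≤
      (M + 2 * ∫⁻ s, Φ s) * ENNReal.ofReal (2 * Real.pi) := by
  rw [← lintegral_comp_polarCoord_symm, polarCoord_target, Measure.volume_eq_prod,
    ← Measure.prod_restrict, lintegral_prod_symm]
  · calc _ ≤ ∫⁻ θ in Set.Ioo (-Real.pi) Real.pi, (M + 2 * ∫⁻ s, Φ s) := by
          refine lintegral_mono fun θ => ?_
          refine le_trans (setLIntegral_mono' measurableSet_Ioi fun r (hr : 0 < r) => ?_)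
            (lintegral_radial_le (Real.cos_sq_add_sin_sq θ) y t hΦ hM)
          rw [smul_eq_mul, ← mul_assoc, ← ENNReal.ofReal_mul hr.le]
          simp only [polarCoord_symm_apply]
          refine le_of_eq ?_
          congr <;> ring
      _ = _ := by
          rw [setLIntegral_const, Real.volume_Ioo]
          congr 2
          ring
  · simp only [polarCoord_symm_apply]
    fun_prop

theorem lconvolution_curve {α β φ ψ : ℝ → ℝ≥0∞} {h g : ℝ → ℝ} (hα : Measurable α)
    (hβ : Measurable β) (hφ : Measurable φ) (hψ : Measurable ψ) (hh : Measurable h)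
    (hg : Measurable g) (q : ℝ × ℝ) :
    ((fun p : ℝ × ℝ => α p.2 * φ (p.1 + h p.2)) ⋆ₗ fun p => β p.2 * ψ (p.1 + g p.2)) q =
      ∫⁻ a, α a * β (-a + q.2) * (φ ⋆ₗ ψ) (q.1 + (h a + g (-a + q.2))) := by
  rw [lconvolution_def, Measure.volume_eq_prod, lintegral_prod_symm]
  · refine lintegral_congr fun a => ?_
    rw [lconvolution_def, ← lintegral_add_right_eq_self
      (fun s => φ s * ψ (-s + (q.1 + (h a + g (-a + q.2))))) (h a),
      ← lintegral_const_mul _ (by fun_prop)]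
    refine lintegral_congr fun s => ?_
    simp only [Prod.fst_add, Prod.snd_add, Prod.fst_neg, Prod.snd_neg]
    rw [show -s + q.1 + g (-a + q.2) = -(s + h a) + (q.1 + (h a + g (-a + q.2))) by ring]
    ring
  · fun_prop

theorem lconvolution_le_of_le {φ ψ : ℝ → ℝ≥0∞} (hφ : Measurable φ) {M : ℝ≥0∞}
    (hM : ∀ s, ψ s ≤ M) (s : ℝ) : (φ ⋆ₗ ψ) s ≤ (∫⁻ x, φ x) * M := by
  rw [lconvolution_def, ← lintegral_mul_const _ hφ]
  exact lintegral_mono fun x => mul_le_mul' le_rfl (hM _)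

theorem lconvolution_lconvolution_quartic_le {α β γ φ : ℝ → ℝ≥0∞} (hα : Measurable α)
    (hβ : Measurable β) (hγ : Measurable γ) (hφ : Measurable φ) (hφ1 : ∀ s, φ s ≤ 1)
    (hαβγ : ∀ x y z, α x * β y * γ z ≤ ENNReal.ofReal (1 + x ^ 2 + y ^ 2 + z ^ 2))
    (q : ℝ × ℝ) :
    ((fun p : ℝ × ℝ => α p.2 * φ (p.1 + p.2 ^ 4)) ⋆ₗ
      (fun p : ℝ × ℝ => β p.2 * φ (p.1 + p.2 ^ 4)) ⋆ₗ
        fun p : ℝ × ℝ => γ p.2 * φ (p.1 + p.2 ^ 4)) q ≤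
      ((∫⁻ s, φ s) * (∫⁻ s, φ s) + 2 * ((∫⁻ s, φ s) * ((∫⁻ s, φ s) * ∫⁻ s, φ s))) *
        ENNReal.ofReal (2 * Real.pi) := by
  have hφφ := measurable_lconvolution volume hφ hφ
  have hΦ := measurable_lconvolution volume hφ hφφ
  have hΦM : ∀ s, (φ ⋆ₗ φ ⋆ₗ φ) s ≤ (∫⁻ s, φ s) * (∫⁻ s, φ s) := by
    refine lconvolution_le_of_le hφ fun s => ?_
    simpa using lconvolution_le_of_le hφ hφ1 s
  have hΦL : ∫⁻ s, (φ ⋆ₗ φ ⋆ₗ φ) s = (∫⁻ s, φ s) * ((∫⁻ s, φ s) * ∫⁻ s, φ s) := by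
    rw [lintegral_lconvolution hφ hφφ, lintegral_lconvolution hφ hφ]
  have h1 : ((fun p : ℝ × ℝ => β p.2 * φ (p.1 + p.2 ^ 4)) ⋆ₗ
        fun p : ℝ × ℝ => γ p.2 * φ (p.1 + p.2 ^ 4)) = fun q : ℝ × ℝ =>
      ∫⁻ c, β c * γ (-c + q.2) * (φ ⋆ₗ φ) (q.1 + (c ^ 4 + (-c + q.2) ^ 4)) := by
    ext q
    exact lconvolution_curve (h := fun x => x ^ 4) (g := fun x => x ^ 4) hβ hγ hφ hφ
      (by fun_prop) (by fun_prop) q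
  have h2 : ((fun p : ℝ × ℝ => α p.2 * φ (p.1 + p.2 ^ 4)) ⋆ₗ
      (fun p : ℝ × ℝ => β p.2 * φ (p.1 + p.2 ^ 4)) ⋆ₗ
        fun p : ℝ × ℝ => γ p.2 * φ (p.1 + p.2 ^ 4)) q =
      ∫⁻ c, ∫⁻ a, α a * (β c * γ (-c + (-a + q.2))) *
        (φ ⋆ₗ φ ⋆ₗ φ) (q.1 + (a ^ 4 + (c ^ 4 + (-c + (-a + q.2)) ^ 4))) := by
    rw [h1, lconvolution_def]
    have e : ∀ y : ℝ × ℝ, α y.2 * φ (y.1 + y.2 ^ 4) *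
        (∫⁻ c, β c * γ (-c + (-y + q).2) *
          (φ ⋆ₗ φ) ((-y + q).1 + (c ^ 4 + (-c + (-y + q).2) ^ 4))) =
        ∫⁻ c, α y.2 * φ (y.1 + y.2 ^ 4) * (β c * γ (-c + (-y + q).2) *
          (φ ⋆ₗ φ) ((-y + q).1 + (c ^ 4 + (-c + (-y + q).2) ^ 4))) := fun y =>
      (lintegral_const_mul _ (by fun_prop)).symm
    simp only [e]
    rw [lintegral_lintegral_swap (by fun_prop)]
    refine lintegral_congr fun c => ?_
    exact lconvolution_curve (α := α) (β := fun x => β c * γ (-c + x)) (φ := φ) (ψ := φ ⋆ₗ φ)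
      (h := fun x => x ^ 4) (g := fun x => c ^ 4 + (-c + x) ^ 4) hα (by fun_prop) hφ hφφ
      (by fun_prop) (by fun_prop) q
  rw [h2, lintegral_lintegral_swap (by fun_prop)]
  set y := q.2 / 3 with hy
  have hm : Measurable fun p : ℝ × ℝ => ENNReal.ofReal
      (1 + p.1 ^ 2 + p.2 ^ 2 + (-p.2 + (-p.1 + q.2)) ^ 2) *
        (φ ⋆ₗ φ ⋆ₗ φ) (q.1 + (p.1 ^ 4 + (p.2 ^ 4 + (-p.2 + (-p.1 + q.2)) ^ 4))) := by
    fun_prop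
  calc _ ≤ ∫⁻ a, ∫⁻ c, ENNReal.ofReal (1 + a ^ 2 + c ^ 2 + (-c + (-a + q.2)) ^ 2) *
        (φ ⋆ₗ φ ⋆ₗ φ) (q.1 + (a ^ 4 + (c ^ 4 + (-c + (-a + q.2)) ^ 4))) := by
        refine lintegral_mono fun a => lintegral_mono fun c => ?_
        rw [← mul_assoc (α a)]
        exact mul_le_mul' (hαβγ _ _ _) le_rfl
    _ = ∫⁻ p : ℝ × ℝ, ENNReal.ofReal (1 + p.1 ^ 2 + p.2 ^ 2 + (-p.2 + (-p.1 + q.2)) ^ 2) *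
        (φ ⋆ₗ φ ⋆ₗ φ) (q.1 + (p.1 ^ 4 + (p.2 ^ 4 + (-p.2 + (-p.1 + q.2)) ^ 4))) := by
        rw [Measure.volume_eq_prod, lintegral_prod _ hm.aemeasurable]
    _ = ∫⁻ p : ℝ × ℝ, ENNReal.ofReal
          (1 + (y + p.1) ^ 2 + (y + p.2) ^ 2 + (y + (-p.1 - p.2)) ^ 2) *
        (φ ⋆ₗ φ ⋆ₗ φ) (q.1 + (y + p.1) ^ 4 + (y + p.2) ^ 4 + (y + (-p.1 - p.2)) ^ 4) := by
        rw [← lintegral_add_left_eq_self _ ((y, y) : ℝ × ℝ)]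
        refine lintegral_congr fun p => ?_
        have e : -(y + p.2) + (-(y + p.1) + q.2) = y + (-p.1 - p.2) := by
          rw [hy]
          ring
        simp only [Prod.fst_add, Prod.snd_add, e, ← add_assoc]
    _ ≤ _ := by
        rw [← hΦL]
        exact lintegral_quartic_level_le y q.1 hΦ hΦM

/-- The power `⟨x⟩ ^ r` with values in `ℝ≥0∞`. -/
noncomputable def bracketWeight (r x : ℝ) : ℝ≥0∞ := ENNReal.ofReal (⟪x⟫ ^ r)

@[fun_prop]
theorem measurable_bracketWeight (r : ℝ) : Measurable (bracketWeight r) := by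
  have := continuous_japaneseBracket.measurable
  unfold bracketWeight
  fun_prop

theorem bracketWeight_sq (r x : ℝ) : bracketWeight r x ^ 2 = bracketWeight (2 * r) x := by
  have h := (japaneseBracket_pos x).le
  rw [bracketWeight, bracketWeight, ← ENNReal.ofReal_pow (by positivity), ← Real.rpow_natCast,
    ← Real.rpow_mul h, mul_comm r]
  norm_num

theorem bracketWeight_neg (r x : ℝ) : bracketWeight r (-x) = bracketWeight r x := by
  rw [bracketWeight, bracketWeight, japaneseBracket_neg]

theorem bracketWeight_le_one {r : ℝ} (hr : r ≤ 0) (x : ℝ) : bracketWeight r x ≤ 1 :=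
  ENNReal.ofReal_le_one.2 (Real.rpow_le_one_of_one_le_of_nonpos (one_le_japaneseBracket x) hr)

theorem lintegral_bracketWeight_ne_top {r : ℝ} (hr : r < -1) :
    ∫⁻ x, bracketWeight r x ≠ ∞ := by
  have h : Integrable fun x : ℝ => (1 + ‖x‖ ^ 2) ^ (-(-r) / 2) :=
    integrable_rpow_neg_one_add_norm_sq (by simpa using by linarith)
  have h2 : Integrable fun x : ℝ => ⟪x⟫ ^ r := by
    refine h.congr (Filter.Eventually.of_forall fun x => ?_)
    simp [japaneseBracket_rpow]
  exact h2.lintegral_lt_top.ne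

theorem bracketWeight_mul_le_two (x y z : ℝ) :
    bracketWeight 1 x * bracketWeight 1 y ≤ ENNReal.ofReal (1 + x ^ 2 + y ^ 2 + z ^ 2) := by
  have hx := (japaneseBracket_pos x).le
  rw [bracketWeight, bracketWeight, ← ENNReal.ofReal_mul (by positivity), Real.rpow_one,
    Real.rpow_one]
  refine ENNReal.ofReal_le_ofReal ?_
  nlinarith [japaneseBracket_sq x, japaneseBracket_sq y, sq_nonneg (⟪x⟫ - ⟪y⟫), sq_nonneg z]

theorem bracketWeight_mul_le_three (x y z : ℝ) :
    bracketWeight (2 / 3) x * bracketWeight (2 / 3) y * bracketWeight (2 / 3) z ≤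
      ENNReal.ofReal (1 + x ^ 2 + y ^ 2 + z ^ 2) := by
  have hx := (japaneseBracket_pos x).le
  have hy := (japaneseBracket_pos y).le
  have hz := (japaneseBracket_pos z).le
  rw [bracketWeight, bracketWeight, bracketWeight, ← ENNReal.ofReal_mul (by positivity),
    ← ENNReal.ofReal_mul (by positivity)]
  refine ENNReal.ofReal_le_ofReal ?_
  have e : ∀ x, ⟪x⟫ ^ (2 / 3 : ℝ) = (⟪x⟫ ^ 2) ^ (1 / 3 : ℝ) := fun x => by
    rw [← Real.rpow_natCast, ← Real.rpow_mul (japaneseBracket_pos x).le]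
    norm_num
  have h := Real.geom_mean_le_arith_mean3_weighted (w₁ := 1 / 3) (w₂ := 1 / 3) (w₃ := 1 / 3)
    (by norm_num) (by norm_num) (by norm_num) (sq_nonneg ⟪x⟫) (sq_nonneg ⟪y⟫) (sq_nonneg ⟪z⟫)
    (by norm_num)
  rw [e, e, e]
  refine h.trans ?_
  rw [japaneseBracket_sq, japaneseBracket_sq, japaneseBracket_sq]
  nlinarith [sq_nonneg x, sq_nonneg y, sq_nonneg z]

/-- The `L²` trilinear estimate for three factors concentrated near the quartic, one of them
reflected. -/
theorem lintegral_quartic_trilinear_sq_le {b : ℝ} (hb : 0 ≤ b) {α β γ : ℝ → ℝ≥0∞}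
    (hα : Measurable α) (hβ : Measurable β) (hγ : Measurable γ)
    (hαβγ : ∀ x y z, α x ^ 2 * β y ^ 2 * γ z ^ 2 ≤ ENNReal.ofReal (1 + x ^ 2 + y ^ 2 + z ^ 2))
    {f₁ f₂ f₃ : ℝ × ℝ → ℝ≥0∞} (hf₁ : Measurable f₁) (hf₂ : Measurable f₂) (hf₃ : Measurable f₃) :
    ∫⁻ q, ((fun p : ℝ × ℝ => α p.2 * bracketWeight (-b) (p.1 + p.2 ^ 4) * f₁ p) ⋆ₗ
      (fun p : ℝ × ℝ =>
        β (-p).2 * bracketWeight (-b) ((-p).1 + (-p).2 ^ 4) * f₂ (-p)) ⋆ₗ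
        fun p : ℝ × ℝ => γ p.2 * bracketWeight (-b) (p.1 + p.2 ^ 4) * f₃ p) q ^ 2 ≤
      ((∫⁻ s, bracketWeight (2 * -b) s) * (∫⁻ s, bracketWeight (2 * -b) s) +
        2 * ((∫⁻ s, bracketWeight (2 * -b) s) *
          ((∫⁻ s, bracketWeight (2 * -b) s) * ∫⁻ s, bracketWeight (2 * -b) s))) *
        ENNReal.ofReal (2 * Real.pi) *
        ((∫⁻ q, f₁ q ^ 2) * ((∫⁻ q, f₃ q ^ 2) * ∫⁻ q, f₂ q ^ 2)) := by
  have hA : Measurable fun p : ℝ × ℝ => α p.2 * bracketWeight (-b) (p.1 + p.2 ^ 4) := by fun_prop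
  have hB : Measurable fun p : ℝ × ℝ => β p.2 * bracketWeight (-b) (p.1 + p.2 ^ 4) := by fun_prop
  have hC : Measurable fun p : ℝ × ℝ => γ p.2 * bracketWeight (-b) (p.1 + p.2 ^ 4) := by fun_prop
  set A := fun p : ℝ × ℝ => α p.2 * bracketWeight (-b) (p.1 + p.2 ^ 4) * f₁ p
  set B := fun p : ℝ × ℝ => β p.2 * bracketWeight (-b) (p.1 + p.2 ^ 4) * f₂ p
  set C := fun p : ℝ × ℝ => γ p.2 * bracketWeight (-b) (p.1 + p.2 ^ 4) * f₃ p
  have hA' : Measurable A := hA.mul hf₁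
  have hB' : Measurable B := hB.mul hf₂
  have hC' : Measurable C := hC.mul hf₃
  have hBn : Measurable fun p => B (-p) := hB'.comp measurable_neg
  have h1 : ∫⁻ q, (A ⋆ₗ (fun p => B (-p)) ⋆ₗ C) q ^ 2 = ∫⁻ q, (A ⋆ₗ C ⋆ₗ B) q ^ 2 := by
    rw [lconvolution_comm (f := fun p => B (-p)), lconvolution_assoc hA' hC' hBn,
      lintegral_lconvolution_neg_sq (measurable_lconvolution volume hA' hC') hB',
      ← lconvolution_assoc hA' hC' hB']
  refine h1.trans_le (lintegral_lconvolution_sq_le_of_le hf₁ hf₃ hf₂ hA hC hB fun q => ?_)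
  simp only [mul_pow, bracketWeight_sq]
  refine lconvolution_lconvolution_quartic_le (hα.pow_const 2) (hγ.pow_const 2) (hβ.pow_const 2)
    (by fun_prop) (bracketWeight_le_one (by linarith)) (fun x y z => ?_) q
  have h := hαβγ x z y
  rw [mul_right_comm]
  refine h.trans_eq ?_
  ring_nf

theorem lintegral_curve_weight {ω φ : ℝ → ℝ≥0∞} (hω : Measurable ω) (hφ : Measurable φ)
    {h : ℝ → ℝ} (hh : Measurable h) (y : ℝ × ℝ) :
    ∫⁻ q : ℝ × ℝ, ω q.2 * φ ((-y + q).1 + h (-y + q).2) = (∫⁻ x, ω x) * ∫⁻ s, φ s := by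
  rw [Measure.volume_eq_prod, lintegral_prod_symm, ← lintegral_mul_const _ hω]
  · refine lintegral_congr fun x => ?_
    dsimp only
    rw [lintegral_const_mul _ (by fun_prop)]
    congr 1
    rw [← lintegral_add_left_eq_self φ (-y.1 + h (-y.2 + x))]
    refine lintegral_congr fun s => ?_
    simp only [Prod.fst_add, Prod.snd_add, Prod.fst_neg, Prod.snd_neg]
    congr 1
    ring
  · fun_prop

/-- The `L²` trilinear estimate with a weight on the output frequency and on one factor, the
first factor being arbitrary. -/
theorem lintegral_weight_trilinear_sq_le {ω φ : ℝ → ℝ≥0∞} (hω : Measurable ω) (hφ : Measurable φ)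
    {g h : ℝ → ℝ} (hg : Measurable g) (hh : Measurable h)
    {f₁ f₂ f₃ : ℝ × ℝ → ℝ≥0∞} (hf₁ : Measurable f₁) (hf₂ : Measurable f₂) (hf₃ : Measurable f₃) :
    ∫⁻ q, (ω q.2 * (f₁ ⋆ₗ (fun p : ℝ × ℝ => ω p.2 * φ (p.1 + g p.2) * f₂ p) ⋆ₗ
        fun p : ℝ × ℝ => φ (p.1 + h p.2) * f₃ p) q) ^ 2 ≤
      ((∫⁻ x, ω x ^ 2) * ∫⁻ s, φ s ^ 2) ^ 2 *
        ((∫⁻ q, f₁ q ^ 2) * ((∫⁻ q, f₂ q ^ 2) * ∫⁻ q, f₃ q ^ 2)) := by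
  have hA : Measurable fun p : ℝ × ℝ => ω p.2 * φ (p.1 + g p.2) := by fun_prop
  have hk : Measurable fun p : ℝ × ℝ => φ (p.1 + h p.2) := by fun_prop
  have hB' : Measurable fun p : ℝ × ℝ => φ (p.1 + h p.2) * f₃ p := hk.mul hf₃
  set A := fun p : ℝ × ℝ => ω p.2 * φ (p.1 + g p.2) * f₂ p
  have hA' : Measurable A := hA.mul hf₂
  have hL : (∫⁻ q, A q) ^ 2 ≤ ((∫⁻ x, ω x ^ 2) * ∫⁻ s, φ s ^ 2) * ∫⁻ q, f₂ q ^ 2 := by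
    refine (lintegral_mul_sq_le hA hf₂).trans_eq ?_
    simp only [mul_pow]
    rw [← lintegral_curve_weight (hω.pow_const 2) (hφ.pow_const 2) hg 0]
    simp
  have e : f₁ ⋆ₗ A ⋆ₗ (fun p : ℝ × ℝ => φ (p.1 + h p.2) * f₃ p) =
      (A ⋆ₗ f₁) ⋆ₗ fun p : ℝ × ℝ => φ (p.1 + h p.2) * f₃ p := by
    rw [lconvolution_assoc hf₁ hA' hB', lconvolution_comm (f := f₁)]
  rw [e]
  refine (lintegral_weight_mul_lconvolution_sq_le (measurable_lconvolution volume hA' hf₁) hf₃ hk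
    (ω := fun q => ω q.2) (by fun_prop) fun y => (lintegral_curve_weight (hω.pow_const 2)
      (hφ.pow_const 2) hh y).le).trans ?_
  calc _ ≤ ((∫⁻ x, ω x ^ 2) * ∫⁻ s, φ s ^ 2) * ((((∫⁻ x, ω x ^ 2) * ∫⁻ s, φ s ^ 2) *
        ∫⁻ q, f₂ q ^ 2) * ∫⁻ q, f₁ q ^ 2) * ∫⁻ q, f₃ q ^ 2 := by
        gcongr
        exact (lintegral_lconvolution_sq_le hA' hf₁).trans (by gcongr)
    _ = _ := by ring

theorem lconvolution_lconvolution_eq {G : Type*} [AddCommGroup G] [MeasurableSpace G]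
    [MeasurableAdd₂ G] [MeasurableNeg G] {ν : Measure G} [SFinite ν] {f g h : G → ℝ≥0∞}
    (hg : Measurable g) (hh : Measurable h) (q : G) :
    (f ⋆ₗ[ν] g ⋆ₗ[ν] h) q = ∫⁻ y, ∫⁻ z, f y * g z * h (-z + (-y + q)) ∂ν ∂ν := by
  rw [lconvolution_def]
  refine lintegral_congr fun y => ?_
  rw [lconvolution_def, ← lintegral_const_mul _ (by fun_prop)]
  exact lintegral_congr fun z => (mul_assoc _ _ _).symm

theorem mul_lconvolution_le_sum {G ι : Type*} [AddCommGroup G] [MeasurableSpace G]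
    [MeasurableAdd₂ G] [MeasurableNeg G] {ν : Measure G} [SFinite ν] [Fintype ι] {f g h : G → ℝ≥0∞}
    (hf : Measurable f) (hg : Measurable g) (hh : Measurable h) {A B C : ι → G → ℝ≥0∞}
    (hA : ∀ i, Measurable (A i)) (hB : ∀ i, Measurable (B i)) (hC : ∀ i, Measurable (C i))
    (c : ℝ≥0∞) (d : ι → ℝ≥0∞) (q : G)
    (H : ∀ x y z, x + y + z = q → c * (f x * g y * h z) ≤ ∑ i, d i * (A i x * B i y * C i z)) :
    c * (f ⋆ₗ[ν] g ⋆ₗ[ν] h) q ≤ ∑ i, d i * (A i ⋆ₗ[ν] B i ⋆ₗ[ν] C i) q := by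
  have e : ∀ (c : ℝ≥0∞) (f g h : G → ℝ≥0∞), Measurable f → Measurable g → Measurable h →
      c * (f ⋆ₗ[ν] g ⋆ₗ[ν] h) q =
        ∫⁻ y, ∫⁻ z, c * (f y * g z * h (-z + (-y + q))) ∂ν ∂ν := by
    intro c f g h hf hg hh
    rw [lconvolution_lconvolution_eq hg hh, ← lintegral_const_mul _ (by fun_prop)]
    refine lintegral_congr fun y => ?_
    rw [← lintegral_const_mul _ (by fun_prop)]
  rw [e c f g h hf hg hh]
  simp only [e _ _ _ _ (hA _) (hB _) (hC _)]
  rw [← lintegral_finsetSum _ (fun i _ => by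
    have := hA i
    have := hB i
    have := hC i
    fun_prop)]
  refine lintegral_mono fun y => ?_
  rw [← lintegral_finsetSum _ (fun i _ => by
    have := hA i
    have := hB i
    have := hC i
    fun_prop)]
  exact lintegral_mono fun z => H _ _ _ (by abel)

theorem IsIMultiplier.bracketWeight_kernel_le {N C₀ b : ℝ} (hb1 : 1 / 2 < b) (hb2 : b ≤ 5 / 6)
    (hN : 1 ≤ N) {m : ℝ → ℝ} (hm : IsIMultiplier N C₀ m) {x y z s s₁ s₂ s₃ : ℝ}
    (hs : s - s₁ - s₂ - s₃ = (x + y + z) ^ 4 - x ^ 4 + y ^ 4 - z ^ 4) :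
    ENNReal.ofReal (m (x + y + z)) * bracketWeight (b - 1) s *
        (bracketWeight (-b) s₁ * bracketWeight (-b) s₂ * bracketWeight (-b) s₃) ≤
      100 * (ENNReal.ofReal (m x) * ENNReal.ofReal (m y) * ENNReal.ofReal (m z)) *
        ((bracketWeight (1 / 2) x * bracketWeight (1 / 2) y +
          bracketWeight (1 / 2) x * bracketWeight (1 / 2) z +
          bracketWeight (1 / 2) y * bracketWeight (1 / 2) z +
          bracketWeight (1 / 3) x * bracketWeight (1 / 3) y * bracketWeight (1 / 3) z) *
            (bracketWeight (-b) s₁ * bracketWeight (-b) s₂ * bracketWeight (-b) s₃) +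
        bracketWeight (-(1 / 4 + b / 2)) (x + y + z) * bracketWeight (-(1 / 4 + b / 2)) y *
          (bracketWeight (-b) s₂ * bracketWeight (-b) s₃) +
        bracketWeight (-(1 / 4 + b / 2)) (x + y + z) * bracketWeight (-(1 / 4 + b / 2)) x *
          (bracketWeight (-b) s₁ * bracketWeight (-b) s₃) +
        bracketWeight (-(1 / 4 + b / 2)) (x + y + z) * bracketWeight (-(1 / 4 + b / 2)) x *
          (bracketWeight (-b) s₁ * bracketWeight (-b) s₂)) := by
  have h := ENNReal.ofReal_le_ofReal (hm.kernel_le hb1 hb2 hN hs)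
  have hx := (hm.pos hN x).le
  have hy := (hm.pos hN y).le
  have hz := (hm.pos hN z).le
  have hσ := (hm.pos hN (x + y + z)).le
  simp (disch := (try unfold japaneseBracket) <;> positivity) only
    [ENNReal.ofReal_mul, ENNReal.ofReal_add, ENNReal.ofReal_ofNat] at h
  exact h

theorem bracketWeight_neg_mul (b x : ℝ) : bracketWeight (-b) x * bracketWeight b x = 1 := by
  have h := japaneseBracket_pos x
  rw [bracketWeight, bracketWeight, ← ENNReal.ofReal_mul (by positivity), ← Real.rpow_add h]
  simp

theorem enorm_spaceTimeFT_mul_le (u v : ℝ × ℝ → ℂ) (hu : ContDiff ℝ (⊤ : ℕ∞) u)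
    (hcu : HasCompactSupport u) (hv : ContDiff ℝ (⊤ : ℕ∞) v) (hcv : HasCompactSupport v)
    (q : ℝ × ℝ) :
    ‖spaceTimeFT (fun p => u p * v p) q.1 q.2‖ₑ ≤
      ((fun q => ‖spaceTimeFT u q.1 q.2‖ₑ) ⋆ₗ fun q => ‖spaceTimeFT v q.1 q.2‖ₑ) q := by
  have hc : ‖(((2 * Real.pi) ^ 2)⁻¹ : ℝ)‖ₑ ≤ 1 := by
    rw [← ofReal_norm, ENNReal.ofReal_le_one, Real.norm_of_nonneg (by positivity)]
    exact inv_le_one_of_one_le₀ (one_le_pow₀ (by linarith [Real.pi_gt_three]))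
  rw [spaceTimeFT_mul u v hu hcu hv hcv, enorm_smul]
  refine (mul_le_mul' hc (enorm_integral_le_lintegral_enorm _)).trans_eq ?_
  rw [one_mul, lconvolution_def]
  refine lintegral_congr fun p => ?_
  rw [enorm_mul, neg_add_eq_sub]

theorem enorm_spaceTimeFT_cubic_le (u : ℝ × ℝ → ℂ) (hu : ContDiff ℝ (⊤ : ℕ∞) u)
    (hc : HasCompactSupport u) (q : ℝ × ℝ) :
    ‖spaceTimeFT (fun p => u p * starRingEnd ℂ (u p) * u p) q.1 q.2‖ₑ ≤
      ((fun q => ‖spaceTimeFT u q.1 q.2‖ₑ) ⋆ₗ (fun q => ‖spaceTimeFT u (-q).1 (-q).2‖ₑ) ⋆ₗ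
        fun q => ‖spaceTimeFT u q.1 q.2‖ₑ) q := by
  have hu' : ContDiff ℝ (⊤ : ℕ∞) fun p => starRingEnd ℂ (u p) :=
    Complex.conjCLE.contDiff.comp hu
  have hc' : HasCompactSupport fun p => starRingEnd ℂ (u p) :=
    hc.comp_left (g := starRingEnd ℂ) (map_zero _)
  simp only [mul_assoc]
  refine (enorm_spaceTimeFT_mul_le u (fun p => starRingEnd ℂ (u p) * u p) hu hc (hu'.mul hu)
    hc.mul_left q).trans ?_
  refine lconvolution_mono (fun _ => le_rfl) (fun p => ?_) q
  refine (enorm_spaceTimeFT_mul_le _ u hu' hc' hu hc p).trans_eq ?_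
  simp only [spaceTimeFT_conj, RCLike.enorm_conj, Prod.fst_neg, Prod.snd_neg]

theorem Xnorm_zero_sq (b : ℝ) (u : ℝ × ℝ → ℂ) :
    Xnorm 0 b u ^ 2 =
      ∫⁻ q : ℝ × ℝ, (bracketWeight b (q.1 + q.2 ^ 4) * ‖spaceTimeFT u q.1 q.2‖ₑ) ^ 2 := by
  rw [Xnorm, eLpNorm_eq_lintegral_rpow_enorm_toReal (by norm_num) (by norm_num),
    ENNReal.toReal_ofNat, ENNReal.rpow_half_sq]
  refine lintegral_congr fun q => ?_
  rw [ENNReal.rpow_two, enorm_mul, bracketWeight, japaneseBracket_rpow, ← ofReal_norm,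
    Complex.norm_real, Real.norm_of_nonneg (by positivity)]
  simp

/-- The constant in the multiplier-weighted trilinear estimate. -/
noncomputable def trilinearConst (b : ℝ) : ℝ≥0∞ :=
  ((∫⁻ s, bracketWeight (2 * -b) s) * (∫⁻ s, bracketWeight (2 * -b) s) +
    2 * ((∫⁻ s, bracketWeight (2 * -b) s) *
      ((∫⁻ s, bracketWeight (2 * -b) s) * ∫⁻ s, bracketWeight (2 * -b) s))) *
    ENNReal.ofReal (2 * Real.pi) +
  ((∫⁻ x, bracketWeight (2 * -(1 / 4 + b / 2)) x) * ∫⁻ s, bracketWeight (2 * -b) s) ^ 2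

theorem trilinearConst_ne_top {b : ℝ} (hb : 1 / 2 < b) : trilinearConst b ≠ ∞ := by
  have h1 := lintegral_bracketWeight_ne_top (r := 2 * -b) (by linarith)
  have h2 := lintegral_bracketWeight_ne_top (r := 2 * -(1 / 4 + b / 2)) (by linarith)
  unfold trilinearConst
  finiteness

theorem lintegral_quartic_trilinear_sq_le' {b : ℝ} (hb : 0 ≤ b) {α β γ : ℝ → ℝ≥0∞}
    (hα : Measurable α) (hβ : Measurable β) (hγ : Measurable γ) (hβn : ∀ x, β (-x) = β x)
    (hαβγ : ∀ x y z, α x ^ 2 * β y ^ 2 * γ z ^ 2 ≤ ENNReal.ofReal (1 + x ^ 2 + y ^ 2 + z ^ 2))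
    {f : ℝ × ℝ → ℝ≥0∞} (hf : Measurable f) :
    ∫⁻ q, ((fun p : ℝ × ℝ => α p.2 * bracketWeight (-b) (p.1 + p.2 ^ 4) * f p) ⋆ₗ
      (fun p : ℝ × ℝ => β p.2 * bracketWeight (-b) (p.1 - p.2 ^ 4) * f (-p)) ⋆ₗ
        fun p : ℝ × ℝ => γ p.2 * bracketWeight (-b) (p.1 + p.2 ^ 4) * f p) q ^ 2 ≤
      trilinearConst b * (∫⁻ q, f q ^ 2) ^ 3 := by
  have e : (fun p : ℝ × ℝ => β p.2 * bracketWeight (-b) (p.1 - p.2 ^ 4) * f (-p)) =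
      fun p : ℝ × ℝ => β (-p).2 * bracketWeight (-b) ((-p).1 + (-p).2 ^ 4) * f (-p) := by
    ext p
    rw [← bracketWeight_neg _ (p.1 - p.2 ^ 4), Prod.snd_neg, Prod.fst_neg, hβn]
    ring_nf
  rw [e]
  refine (lintegral_quartic_trilinear_sq_le hb hα hβ hγ hαβγ hf hf hf).trans ?_
  rw [trilinearConst, add_mul (_ * ENNReal.ofReal _)]
  refine le_trans (le_of_eq ?_) le_self_add
  ring

theorem lintegral_weight_trilinear_sq_le' {b : ℝ} {g h : ℝ → ℝ} (hg : Measurable g)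
    (hh : Measurable h) {f f₁ f₂ f₃ : ℝ × ℝ → ℝ≥0∞} (hf₁ : Measurable f₁) (hf₂ : Measurable f₂)
    (hf₃ : Measurable f₃) (h₁ : ∫⁻ q, f₁ q ^ 2 = ∫⁻ q, f q ^ 2)
    (h₂ : ∫⁻ q, f₂ q ^ 2 = ∫⁻ q, f q ^ 2) (h₃ : ∫⁻ q, f₃ q ^ 2 = ∫⁻ q, f q ^ 2) :
    ∫⁻ q, (bracketWeight (-(1 / 4 + b / 2)) q.2 * (f₁ ⋆ₗ
      (fun p : ℝ × ℝ => bracketWeight (-(1 / 4 + b / 2)) p.2 *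
        bracketWeight (-b) (p.1 + g p.2) * f₂ p) ⋆ₗ
        fun p : ℝ × ℝ => bracketWeight (-b) (p.1 + h p.2) * f₃ p) q) ^ 2 ≤
      trilinearConst b * (∫⁻ q, f q ^ 2) ^ 3 := by
  refine (lintegral_weight_trilinear_sq_le (by fun_prop) (by fun_prop) hg hh hf₁ hf₂ hf₃).trans ?_
  rw [trilinearConst, add_mul, h₁, h₂, h₃]
  simp only [bracketWeight_sq]
  refine le_trans (le_of_eq ?_) le_add_self
  ring

theorem IsIMultiplier.lintegral_trilinear_sq_le {N C₀ b : ℝ} (hb1 : 1 / 2 < b) (hb2 : b ≤ 5 / 6)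
    (hN : 1 ≤ N) {m : ℝ → ℝ} (hm : IsIMultiplier N C₀ m) {F : ℝ × ℝ → ℝ≥0∞} (hF : Measurable F) :
    ∫⁻ q : ℝ × ℝ, (ENNReal.ofReal (m q.2) * bracketWeight (b - 1) (q.1 + q.2 ^ 4) *
        (F ⋆ₗ (fun p => F (-p)) ⋆ₗ F) q) ^ 2 ≤
      490000 * trilinearConst b * (∫⁻ q : ℝ × ℝ,
        (bracketWeight b (q.1 + q.2 ^ 4) * (ENNReal.ofReal (m q.2) * F q)) ^ 2) ^ 3 := by
  have hmm : Measurable m := hm.1.continuous.measurable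
  set f : ℝ × ℝ → ℝ≥0∞ := fun q =>
    bracketWeight b (q.1 + q.2 ^ 4) * (ENNReal.ofReal (m q.2) * F q) with hfdef
  have hf : Measurable f := by fun_prop
  have hf' : Measurable fun p => f (-p) := hf.comp measurable_neg
  have hF' : Measurable fun p => F (-p) := hF.comp measurable_neg
  have hfn : ∫⁻ q, f (-q) ^ 2 = ∫⁻ q, f q ^ 2 :=
    lintegral_neg_eq_self (fun q => f q ^ 2)
  set p := -(1 / 4 + b / 2)
  set d : Fin 7 → ℝ → ℝ≥0∞ := ![1, 1, 1, 1, bracketWeight p, bracketWeight p, bracketWeight p]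
  let Φ : (ℝ → ℝ≥0∞) → ℝ × ℝ → ℝ≥0∞ := fun α q =>
    α q.2 * bracketWeight (-b) (q.1 + q.2 ^ 4) * f q
  let Ψ : (ℝ → ℝ≥0∞) → ℝ × ℝ → ℝ≥0∞ := fun α q =>
    α q.2 * bracketWeight (-b) (q.1 - q.2 ^ 4) * f (-q)
  have hΦ : ∀ α, Measurable α → Measurable (Φ α) := fun α hα => by
    change Measurable fun q : ℝ × ℝ => α q.2 * bracketWeight (-b) (q.1 + q.2 ^ 4) * f q
    fun_prop
  have hΨ : ∀ α, Measurable α → Measurable (Ψ α) := fun α hα => by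
    change Measurable fun q : ℝ × ℝ => α q.2 * bracketWeight (-b) (q.1 - q.2 ^ 4) * f (-q)
    fun_prop
  let J := bracketWeight (1 / 2)
  let L := bracketWeight (1 / 3)
  have hJ : Measurable J := measurable_bracketWeight _
  have hL : Measurable L := measurable_bracketWeight _
  have h1 : Measurable (1 : ℝ → ℝ≥0∞) := measurable_one
  have hω : Measurable (bracketWeight p) := measurable_bracketWeight _
  let A : Fin 7 → ℝ × ℝ → ℝ≥0∞ := ![Φ J, Φ J, Φ 1, Φ L, f, Φ (bracketWeight p), Φ (bracketWeight p)]
  let B : Fin 7 → ℝ × ℝ → ℝ≥0∞ := ![Ψ J, Ψ 1, Ψ J, Ψ L, Ψ (bracketWeight p), fun q => f (-q), Ψ 1]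
  let C : Fin 7 → ℝ × ℝ → ℝ≥0∞ := ![Φ 1, Φ J, Φ J, Φ L, Φ 1, Φ 1, f]
  have hA : ∀ i, Measurable (A i) := by
    intro i
    fin_cases i
    exacts [hΦ _ hJ, hΦ _ hJ, hΦ _ h1, hΦ _ hL, hf, hΦ _ hω, hΦ _ hω]
  have hB : ∀ i, Measurable (B i) := by
    intro i
    fin_cases i
    exacts [hΨ _ hJ, hΨ _ h1, hΨ _ hJ, hΨ _ hL, hΨ _ hω, hf', hΨ _ h1]
  have hC : ∀ i, Measurable (C i) := by
    intro i
    fin_cases i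
    exacts [hΦ _ h1, hΦ _ hJ, hΦ _ hJ, hΦ _ hL, hΦ _ h1, hΦ _ h1, hf]
  have hd' : ∀ i, Measurable (d i) := by
    intro i
    fin_cases i
    exacts [h1, h1, h1, h1, hω, hω, hω]
  have hpt : ∀ q : ℝ × ℝ, ENNReal.ofReal (m q.2) * bracketWeight (b - 1) (q.1 + q.2 ^ 4) *
        (F ⋆ₗ (fun p => F (-p)) ⋆ₗ F) q ≤
      ∑ i, 100 * d i q.2 * (A i ⋆ₗ B i ⋆ₗ C i) q := by
    intro q
    refine mul_lconvolution_le_sum hF hF' hF hA hB hC _ _ q fun x y z hq => ?_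
    subst hq
    have hk := hm.bracketWeight_kernel_le hb1 hb2 hN (x := x.2) (y := y.2) (z := z.2)
      (s := (x + y + z).1 + (x + y + z).2 ^ 4) (s₁ := x.1 + x.2 ^ 4) (s₂ := y.1 - y.2 ^ 4)
      (s₃ := z.1 + z.2 ^ 4) (by simp only [Prod.fst_add, Prod.snd_add]; ring)
    have hk' := mul_le_mul' hk (le_refl (bracketWeight b (x.1 + x.2 ^ 4) * F x *
      (bracketWeight b (y.1 - y.2 ^ 4) * F (-y)) * (bracketWeight b (z.1 + z.2 ^ 4) * F z)))
    have hfy : f (-y) = bracketWeight b (y.1 - y.2 ^ 4) * (ENNReal.ofReal (m y.2) * F (-y)) := by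
      simp only [hfdef]
      rw [← bracketWeight_neg _ (y.1 - y.2 ^ 4), Prod.snd_neg, Prod.fst_neg, hm.2.1]
      ring_nf
    refine le_trans (le_of_eq ?_) (hk'.trans (le_of_eq ?_))
    · calc _ = ENNReal.ofReal (m (x.2 + y.2 + z.2)) *
            bracketWeight (b - 1) ((x + y + z).1 + (x + y + z).2 ^ 4) * (F x * F (-y) * F z) *
            ((bracketWeight (-b) (x.1 + x.2 ^ 4) * bracketWeight b (x.1 + x.2 ^ 4)) *
            (bracketWeight (-b) (y.1 - y.2 ^ 4) * bracketWeight b (y.1 - y.2 ^ 4)) *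
            (bracketWeight (-b) (z.1 + z.2 ^ 4) * bracketWeight b (z.1 + z.2 ^ 4))) := by
            simp only [bracketWeight_neg_mul, mul_one, Prod.snd_add]
        _ = _ := by ring
    · rw [Fin.sum_univ_seven]
      change _ = 100 * 1 * (Φ J x * Ψ J y * Φ 1 z) + 100 * 1 * (Φ J x * Ψ 1 y * Φ J z) +
        100 * 1 * (Φ 1 x * Ψ J y * Φ J z) + 100 * 1 * (Φ L x * Ψ L y * Φ L z) +
        100 * bracketWeight p (x + y + z).2 * (f x * Ψ (bracketWeight p) y * Φ 1 z) +
        100 * bracketWeight p (x + y + z).2 * (Φ (bracketWeight p) x * f (-y) * Φ 1 z) +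
        100 * bracketWeight p (x + y + z).2 * (Φ (bracketWeight p) x * Ψ 1 y * f z)
      simp only [Φ, Ψ, J, L, hfy, Prod.snd_add, Pi.one_apply]
      simp only [hfdef]
      ring
  have hbound : ∀ i, ∫⁻ q : ℝ × ℝ, (d i q.2 * (A i ⋆ₗ B i ⋆ₗ C i) q) ^ 2 ≤
      trilinearConst b * (∫⁻ q, f q ^ 2) ^ 3 := by
    have hJn : ∀ x, J (-x) = J x := bracketWeight_neg _
    have hJ2 : ∀ x, J x ^ 2 = bracketWeight 1 x := fun x => by
      rw [bracketWeight_sq]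
      norm_num
    have hL2 : ∀ x, L x ^ 2 = bracketWeight (2 / 3) x := fun x => by
      rw [bracketWeight_sq]
      norm_num
    have hS : ∀ α β γ : ℝ → ℝ≥0∞, Measurable α → Measurable β → Measurable γ →
        (∀ x, β (-x) = β x) → (∀ x y z, α x ^ 2 * β y ^ 2 * γ z ^ 2 ≤
          ENNReal.ofReal (1 + x ^ 2 + y ^ 2 + z ^ 2)) →
        ∫⁻ q : ℝ × ℝ, ((1 : ℝ → ℝ≥0∞) q.2 * (Φ α ⋆ₗ Ψ β ⋆ₗ Φ γ) q) ^ 2 ≤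
          trilinearConst b * (∫⁻ q, f q ^ 2) ^ 3 := by
      intro α β γ hα hβ hγ hβn h
      simp only [Pi.one_apply, one_mul]
      exact lintegral_quartic_trilinear_sq_le' (by linarith) hα hβ hγ hβn h hf
    have hΦ1 : Φ 1 = fun q : ℝ × ℝ => bracketWeight (-b) (q.1 + q.2 ^ 4) * f q := by
      ext q
      simp [Φ]
    have hΨ1 : Ψ 1 = fun q : ℝ × ℝ => bracketWeight (-b) (q.1 + -q.2 ^ 4) * f (-q) := by
      ext q
      simp [Ψ, sub_eq_add_neg]
    have hΨω : Ψ (bracketWeight p) = fun q : ℝ × ℝ => bracketWeight p q.2 *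
        bracketWeight (-b) (q.1 + -q.2 ^ 4) * f (-q) := by
      ext q
      simp [Ψ, sub_eq_add_neg]
    intro i
    fin_cases i
    · refine hS J J 1 hJ hJ h1 hJn fun x y z => ?_
      simpa [hJ2] using bracketWeight_mul_le_two x y z
    · refine hS J 1 J hJ h1 hJ (fun _ => rfl) fun x y z => ?_
      simpa [hJ2, add_right_comm] using bracketWeight_mul_le_two x z y
    · refine hS 1 J J h1 hJ hJ hJn fun x y z => ?_
      have h := bracketWeight_mul_le_two y z x
      rw [show 1 + y ^ 2 + z ^ 2 + x ^ 2 = 1 + x ^ 2 + y ^ 2 + z ^ 2 by ring] at h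
      simpa [hJ2] using h
    · refine hS L L L hL hL hL (bracketWeight_neg _) fun x y z => ?_
      simpa [hL2] using bracketWeight_mul_le_three x y z
    · change ∫⁻ q : ℝ × ℝ, (bracketWeight p q.2 * (f ⋆ₗ Ψ (bracketWeight p) ⋆ₗ Φ 1) q) ^ 2 ≤ _
      rw [hΦ1, hΨω]
      exact lintegral_weight_trilinear_sq_le' (g := fun x => -x ^ 4) (h := fun x => x ^ 4)
        (by fun_prop) (by fun_prop) hf hf' hf rfl hfn rfl
    · change ∫⁻ q : ℝ × ℝ, (bracketWeight p q.2 *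
        (Φ (bracketWeight p) ⋆ₗ (fun q => f (-q)) ⋆ₗ Φ 1) q) ^ 2 ≤ _
      rw [lconvolution_assoc (hΦ _ hω) hf' (hΦ _ h1), lconvolution_comm (f := Φ (bracketWeight p)),
        ← lconvolution_assoc hf' (hΦ _ hω) (hΦ _ h1), hΦ1]
      exact lintegral_weight_trilinear_sq_le' (g := fun x => x ^ 4) (h := fun x => x ^ 4)
        (by fun_prop) (by fun_prop) hf' hf hf hfn rfl rfl
    · change ∫⁻ q : ℝ × ℝ, (bracketWeight p q.2 *
        (Φ (bracketWeight p) ⋆ₗ Ψ 1 ⋆ₗ f) q) ^ 2 ≤ _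
      rw [lconvolution_assoc (hΦ _ hω) (hΨ _ h1) hf, lconvolution_comm (g := f), hΨ1]
      exact lintegral_weight_trilinear_sq_le' (g := fun x => x ^ 4) (h := fun x => -x ^ 4)
        (by fun_prop) (by fun_prop) hf hf hf' rfl rfl hfn
  have hT : ∀ i, Measurable fun q : ℝ × ℝ => d i q.2 * (A i ⋆ₗ B i ⋆ₗ C i) q := fun i =>
    ((hd' i).comp measurable_snd).mul
      (measurable_lconvolution _ (hA i) (measurable_lconvolution _ (hB i) (hC i)))
  have hsq : ∀ q : ℝ × ℝ, (∑ i, 100 * d i q.2 * (A i ⋆ₗ B i ⋆ₗ C i) q) ^ 2 ≤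
      70000 * ∑ i, (d i q.2 * (A i ⋆ₗ B i ⋆ₗ C i) q) ^ 2 := by
    intro q
    have h := ENNReal.rpow_sum_le_const_mul_sum_rpow Finset.univ
      (fun i => d i q.2 * (A i ⋆ₗ B i ⋆ₗ C i) q) (p := 2) (by norm_num)
    simp only [ENNReal.rpow_two, Finset.card_univ, Fintype.card_fin] at h
    norm_num at h
    simp only [mul_assoc (100 : ℝ≥0∞), ← Finset.mul_sum]
    rw [mul_pow]
    refine (mul_le_mul' le_rfl h).trans_eq ?_
    rw [← mul_assoc]
    norm_num
  calc _ ≤ ∫⁻ q : ℝ × ℝ, 70000 * ∑ i, (d i q.2 * (A i ⋆ₗ B i ⋆ₗ C i) q) ^ 2 :=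
        lintegral_mono fun q => (pow_le_pow_left₀ zero_le (hpt q) 2).trans (hsq q)
    _ = 70000 * ∑ i, ∫⁻ q : ℝ × ℝ, (d i q.2 * (A i ⋆ₗ B i ⋆ₗ C i) q) ^ 2 := by
        rw [lintegral_const_mul _ (Finset.measurable_fun_sum _ fun i _ => (hT i).pow_const 2),
          lintegral_finsetSum _ fun i _ => (hT i).pow_const 2]
    _ ≤ 70000 * ∑ _i : Fin 7, trilinearConst b * (∫⁻ q, f q ^ 2) ^ 3 := by
        gcongr with i
        exact hbound i
    _ = _ := by
        rw [Finset.sum_const, Finset.card_univ, Fintype.card_fin, nsmul_eq_mul, ← mul_assoc,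
          mul_assoc 490000, show (70000 : ℝ≥0∞) * (7 : ℕ) = 490000 by norm_num]

/-- Modified trilinear estimate for the `I`-method, uniform in `N`:
`‖I(u ū u)‖_{X^{0,b-1}} ≤ C ‖Iu‖_{X^{0,b}}³` for time-localized smooth `u`. -/
theorem stmt_15 (b C₀ : ℝ) (hb1 : 1/2 < b) (hb2 : b ≤ 5/6) (hC₀ : 0 < C₀) :
    ∃ C > (0:ℝ), ∀ N : ℝ, 1 ≤ N → ∀ m : ℝ → ℝ, IsIMultiplier N C₀ m →
      ∀ u : ℝ × ℝ → ℂ, ContDiff ℝ (⊤ : ℕ∞) u → HasCompactSupport u →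
        (Function.support u ⊆ {p : ℝ × ℝ | |p.1| ≤ 2}) →
        Xnorm 0 (b - 1) (IopST m (fun p => u p * (starRingEnd ℂ) (u p) * u p)) ≤
          ENNReal.ofReal C * Xnorm 0 b (IopST m u) ^ 3 := by
  have hfin : 490000 * trilinearConst b ≠ ∞ :=
    ENNReal.mul_ne_top (by norm_num) (trilinearConst_ne_top hb1)
  refine ⟨(490000 * trilinearConst b).toReal + 1, by positivity, ?_⟩
  intro N hN m hm u hu hc _
  set C := ENNReal.ofReal ((490000 * trilinearConst b).toReal + 1) with hC
  have hC1 : 1 ≤ C := ENNReal.one_le_ofReal.2 (le_add_of_nonneg_left ENNReal.toReal_nonneg)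
  have hKC : 490000 * trilinearConst b ≤ C := by
    rw [ENNReal.le_ofReal_iff_toReal_le hfin (by positivity)]
    linarith
  have hu3 : ContDiff ℝ (⊤ : ℕ∞) fun p => u p * (starRingEnd ℂ) (u p) * u p :=
    (hu.mul (Complex.conjCLE.contDiff.comp hu)).mul hu
  have hc3 : HasCompactSupport fun p => u p * (starRingEnd ℂ) (u p) * u p := hc.mul_left
  have he : ∀ ξ, ‖(m ξ : ℂ)‖ₑ = ENNReal.ofReal (m ξ) := fun ξ => by
    rw [← ofReal_norm, Complex.norm_real, Real.norm_of_nonneg (hm.pos hN ξ).le]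
  rw [← ENNReal.pow_le_pow_left_iff two_ne_zero, Xnorm_zero_sq]
  simp only [spaceTimeFT_IopST hN hm _ hu3 hc3, enorm_mul, he]
  have hF : Measurable fun q : ℝ × ℝ => ‖spaceTimeFT u q.1 q.2‖ₑ :=
    (continuous_spaceTimeFT u hu hc).measurable.enorm
  calc _ ≤ ∫⁻ q : ℝ × ℝ, (ENNReal.ofReal (m q.2) * bracketWeight (b - 1) (q.1 + q.2 ^ 4) *
        ((fun q => ‖spaceTimeFT u q.1 q.2‖ₑ) ⋆ₗ (fun q => ‖spaceTimeFT u (-q).1 (-q).2‖ₑ) ⋆ₗ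
          fun q => ‖spaceTimeFT u q.1 q.2‖ₑ) q) ^ 2 := by
        refine lintegral_mono fun q => pow_le_pow_left₀ zero_le ?_ 2
        rw [mul_left_comm, ← mul_assoc]
        exact mul_le_mul' le_rfl (enorm_spaceTimeFT_cubic_le u hu hc q)
    _ ≤ 490000 * trilinearConst b * (Xnorm 0 b (IopST m u) ^ 2) ^ 3 := by
        refine (hm.lintegral_trilinear_sq_le hb1 hb2 hN hF).trans_eq ?_
        rw [Xnorm_zero_sq]
        simp only [spaceTimeFT_IopST hN hm _ hu hc, enorm_mul, he]
    _ ≤ C ^ 2 * (Xnorm 0 b (IopST m u) ^ 2) ^ 3 := by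
        gcongr
        exact hKC.trans (le_self_pow₀ hC1 two_ne_zero)
    _ = _ := by ring
end

section
/- Let s ≥ 0. There exists a constant C₁ > 0, depending only on s, such that for every Schwartz function u on ℝ, every A > 0, x₀ ∈ ℝ, M > 1, and τ > 0 with Mτ ≥ 1, the function v(x) = A e^{iMx} u((x − x₀)/τ) satisfies ‖v‖_{H^s} ≤ C₁ A τ^{1/2} M^s ‖u‖_{H^s}. -/
open MeasureTheory Complex
open scoped ENNReal

/-- The Fourier transform `û(ξ) = ∫ e^{-ixξ} u(x) dx`. -/
noncomputable def fourierInt (u : ℝ → ℂ) (ξ : ℝ) : ℂ :=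
  ∫ x : ℝ, Complex.exp (-(Complex.I * x * ξ)) * u x

/-- The Sobolev norm `‖u‖_{H^s} = ‖⟨ξ⟩^s û(ξ)‖_{L²_ξ}`, `⟨ξ⟩ = (1+ξ²)^{1/2}`. -/
noncomputable def HsNorm (s : ℝ) (u : ℝ → ℂ) : ℝ≥0∞ :=
  eLpNorm (fun ξ : ℝ => (((1 + ξ^2) ^ (s/2) : ℝ) : ℂ) * fourierInt u ξ) 2 volume

/-- The Fourier transform of a modulated, translated and dilated function. -/
theorem fourierInt_modulate_dilate (u : ℝ → ℂ) (A x₀ M : ℝ) {τ : ℝ} (hτ : 0 < τ) (ξ : ℝ) :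
    fourierInt (fun x => (A : ℂ) * Complex.exp (Complex.I * M * x) * u ((x - x₀) / τ)) ξ =
      (A * τ : ℂ) * Complex.exp (((-(x₀ * (ξ - M)) : ℝ) : ℂ) * Complex.I) *
        fourierInt u (τ * (ξ - M)) := by
  unfold fourierInt
  rw [← integral_add_right_eq_self _ x₀]
  have h := Measure.integral_comp_mul_left (fun x : ℝ => Complex.exp (-(Complex.I * (x + x₀ : ℝ) * ξ)) *
    ((A : ℂ) * Complex.exp (Complex.I * M * (x + x₀ : ℝ)) * u ((x + x₀ - x₀) / τ))) τ
  rw [abs_of_pos (inv_pos.2 hτ), eq_inv_smul_iff₀ hτ.ne'] at h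
  rw [← h, Complex.real_smul, mul_comm (A : ℂ), mul_assoc, mul_assoc]
  congr 1
  rw [← integral_const_mul, ← integral_const_mul]
  congr 1
  funext y
  rw [add_sub_cancel_right, mul_div_cancel_left₀ _ hτ.ne']
  have e : Complex.exp (-(Complex.I * (τ * y + x₀ : ℝ) * ξ)) *
      Complex.exp (Complex.I * M * (τ * y + x₀ : ℝ)) =
      Complex.exp (((-(x₀ * (ξ - M)) : ℝ) : ℂ) * Complex.I) *
        Complex.exp (-(Complex.I * y * (τ * (ξ - M) : ℝ))) := by
    rw [← Complex.exp_add, ← Complex.exp_add]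
    congr 1
    push_cast
    ring
  linear_combination (A * u y) * e

/-- Scaling of the `L²` norm under an affine change of variables. -/
theorem eLpNorm_two_comp_mul_sub (G : ℝ → ℂ) (M : ℝ) {τ : ℝ} (hτ : 0 < τ) :
    eLpNorm (fun ξ => G (τ * (ξ - M))) 2 volume =
      ENNReal.ofReal (τ⁻¹ ^ ((1:ℝ)/2)) * eLpNorm G 2 volume := by
  have h₁ := (measurableEmbedding_subRight M).eLpNorm_map_measure
    (μ := (volume : Measure ℝ)) (p := 2) (g := fun ξ => G (τ * ξ))
  have h₂ := (measurableEmbedding_mulLeft₀ hτ.ne').eLpNorm_map_measure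
    (μ := (volume : Measure ℝ)) (p := 2) (g := G)
  rw [(measurePreserving_sub_right volume M).map_eq] at h₁
  rw [Real.map_volume_mul_left hτ.ne', eLpNorm_smul_measure_of_ne_top (by simp),
    abs_of_pos (inv_pos.2 hτ)] at h₂
  calc eLpNorm (fun ξ => G (τ * (ξ - M))) 2 volume
      = eLpNorm (fun ξ => G (τ * ξ)) 2 volume := h₁.symm
    _ = _ := h₂.symm
    _ = _ := by
      rw [smul_eq_mul, ENNReal.ofReal_rpow_of_pos (inv_pos.2 hτ)]
      norm_num

/-- The Japanese bracket at `ξ` is controlled by `M` times the bracket at `τ (ξ - M)`. -/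
theorem bracket_rpow_le {s M τ : ℝ} (hs : 0 ≤ s) (hM : 1 < M) (hMτ : 1 ≤ M * τ) (ξ : ℝ) :
    (1 + ξ ^ 2) ^ (s / 2) ≤ 3 ^ (s / 2) * M ^ s * (1 + (τ * (ξ - M)) ^ 2) ^ (s / 2) := by
  have hM0 : 0 < M := by linarith
  have key : 1 + ξ ^ 2 ≤ 3 * M ^ 2 * (1 + (τ * (ξ - M)) ^ 2) := by
    have h₁ : (ξ - M) ^ 2 ≤ (M * τ) ^ 2 * (ξ - M) ^ 2 :=
      le_mul_of_one_le_left (sq_nonneg _) (one_le_pow₀ hMτ)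
    nlinarith [sq_nonneg (ξ - 2 * M), sq_nonneg (M * (τ * (ξ - M)))]
  have hMs : M ^ s = (M ^ 2) ^ (s / 2) := by
    rw [← Real.rpow_natCast, ← Real.rpow_mul hM0.le]
    congr 1
    push_cast
    ring
  rw [hMs, ← Real.mul_rpow (by norm_num) (by positivity),
    ← Real.mul_rpow (by positivity) (by positivity)]
  exact Real.rpow_le_rpow (by positivity) key (by positivity)

/-- `H^s` bound (`s ≥ 0`) for high-frequency modulations: if `Mτ ≥ 1` then
`v(x) = A e^{iMx} u((x-x₀)/τ)` satisfies `‖v‖_{H^s} ≤ C₁ A τ^{1/2} M^s ‖u‖_{H^s}`. -/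
theorem stmt_16 (s : ℝ) (hs : 0 ≤ s) :
    ∃ C₁ > (0:ℝ), ∀ u : SchwartzMap ℝ ℂ, ∀ A x₀ M τ : ℝ,
      0 < A → 1 < M → 0 < τ → 1 ≤ M * τ →
      HsNorm s (fun x => (A : ℂ) * Complex.exp (Complex.I * M * x) * u ((x - x₀) / τ)) ≤
        ENNReal.ofReal (C₁ * A * τ ^ ((1:ℝ)/2) * M ^ s) * HsNorm s (fun x => u x) := by
  refine ⟨3 ^ (s / 2), by positivity, fun u A x₀ M τ hA hM hτ hMτ => ?_⟩
  have hM0 : 0 < M := by linarith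
  unfold HsNorm
  set G : ℝ → ℂ := fun ξ => (((1 + ξ ^ 2) ^ (s / 2) : ℝ) : ℂ) * fourierInt (fun x => u x) ξ with hG
  have hconst : 3 ^ (s / 2) * A * τ ^ ((1:ℝ)/2) * M ^ s =
      (3 ^ (s / 2) * M ^ s * (A * τ)) * τ⁻¹ ^ ((1:ℝ)/2) := by
    have h : τ ^ ((1:ℝ)/2) = τ * τ⁻¹ ^ ((1:ℝ)/2) := by
      rw [Real.inv_rpow hτ.le, ← Real.rpow_neg hτ.le]
      nth_rewrite 2 [← Real.rpow_one τ]
      rw [← Real.rpow_add hτ]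
      norm_num
    rw [h]
    ring
  rw [hconst, ENNReal.ofReal_mul (by positivity), mul_assoc, ← eLpNorm_two_comp_mul_sub G M hτ]
  refine eLpNorm_le_mul_eLpNorm_of_ae_le_mul (.of_forall fun ξ => ?_) 2
  rw [fourierInt_modulate_dilate (fun x => u x) A x₀ M hτ ξ, hG]
  simp only [norm_mul, Complex.norm_exp_ofReal_mul_I, Complex.norm_real, mul_one,
    Real.norm_of_nonneg hA.le, Real.norm_of_nonneg hτ.le]
  rw [Real.norm_of_nonneg (by positivity), Real.norm_of_nonneg (by positivity)]
  calc _ ≤ (3 ^ (s / 2) * M ^ s * (1 + (τ * (ξ - M)) ^ 2) ^ (s / 2)) *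
        (A * τ * ‖fourierInt (fun x => u x) (τ * (ξ - M))‖) := by
        gcongr
        exact bracket_rpow_le hs hM hMτ ξ
    _ = _ := by ring
end

section
/- Let s < 0 and σ ≥ |s|. There exists a constant C₁ > 0, depending only on s and σ, such that for every Schwartz function u on ℝ, every A > 0, x₀ ∈ ℝ, M > 1, and τ > 0 with 1 ≤ τ · M^{1 + s/σ}, the function v(x) = A e^{iMx} u((x − x₀)/τ) satisfies ‖v‖_{H^s} ≤ C₁ A τ^{1/2} M^s ‖u‖_{H^σ}. -/
open MeasureTheory Complex
open scoped ENNReal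

/-- Fourier transform of a modulated and rescaled function. -/
lemma fourierInt_modulation (u : ℝ → ℂ) (A x₀ M τ ξ : ℝ) (hτ : 0 < τ) :
    fourierInt (fun x => (A : ℂ) * Complex.exp (Complex.I * M * x) * u ((x - x₀) / τ)) ξ =
      (A * τ : ℂ) * Complex.exp (Complex.I * x₀ * (M - ξ)) * fourierInt u (τ * (ξ - M)) := by
  have hτ' : (τ : ℂ) ≠ 0 := by exact_mod_cast hτ.ne'
  set F : ℝ → ℂ := fun y => (A : ℂ) * Complex.exp (Complex.I * x₀ * (M - ξ)) *
    (Complex.exp (-(Complex.I * y * (τ * (ξ - M) : ℝ))) * u y) with hF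
  have h : ∀ x : ℝ, Complex.exp (-(Complex.I * x * ξ)) *
      ((A : ℂ) * Complex.exp (Complex.I * M * x) * u ((x - x₀) / τ)) = F ((x - x₀) / τ) := by
    intro x
    have e : Complex.exp (-(Complex.I * x * ξ)) * Complex.exp (Complex.I * M * x) =
        Complex.exp (Complex.I * x₀ * (M - ξ)) *
          Complex.exp (-(Complex.I * ((x - x₀) / τ : ℝ) * (τ * (ξ - M) : ℝ))) := by
      rw [← Complex.exp_add, ← Complex.exp_add]
      congr 1
      push_cast
      field_simp
      ring
    simp only [hF]
    linear_combination (A : ℂ) * u ((x - x₀) / τ) * e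
  unfold fourierInt
  simp_rw [h]
  rw [integral_sub_right_eq_self (fun x => F (x / τ)) x₀, Measure.integral_comp_div F τ, hF,
    integral_const_mul, abs_of_pos hτ, Complex.real_smul]
  ring

/-- Behaviour of the `L²` norm under an affine change of variables. -/
lemma eLpNorm_two_comp_affine (g : ℝ → ℂ) (M τ : ℝ) (hτ : 0 < τ) :
    eLpNorm (fun ξ => g (τ * (ξ - M))) 2 volume =
      ENNReal.ofReal (τ ^ (-(1 : ℝ) / 2)) * eLpNorm g 2 volume := by
  have e₁ : MeasurableEmbedding (fun x : ℝ => τ * x) :=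
    (Homeomorph.mulLeft₀ τ hτ.ne').measurableEmbedding
  have e₂ : MeasurableEmbedding (fun x : ℝ => x - M) :=
    (Homeomorph.subRight M).measurableEmbedding
  have h₂ := e₂.eLpNorm_map_measure (g := fun x => g (τ * x)) (p := 2) (μ := volume)
  rw [(measurePreserving_sub_right volume M).map_eq] at h₂
  have h₁ := e₁.eLpNorm_map_measure (g := g) (p := 2) (μ := volume)
  rw [Real.map_volume_mul_left hτ.ne', eLpNorm_smul_measure_of_ne_top (by simp)] at h₁
  calc eLpNorm (fun ξ => g (τ * (ξ - M))) 2 volume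
      = eLpNorm (fun x => g (τ * x)) 2 volume := h₂.symm
    _ = _ := h₁.symm
    _ = _ := by
      rw [abs_of_pos (inv_pos.2 hτ), ENNReal.ofReal_rpow_of_pos (inv_pos.2 hτ), smul_eq_mul,
        Real.inv_rpow hτ.le, ← Real.rpow_neg hτ.le]
      norm_num

/-- Comparison of the weights at frequencies `ξ` and `τ (ξ - M)`. -/
lemma weight_le (s σ M τ ξ : ℝ) (hs : s < 0) (hσ : |s| ≤ σ) (hM : 1 < M) (hτ : 0 < τ)
    (h : 1 ≤ τ * M ^ (1 + s / σ)) :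
    (1 + ξ ^ 2) ^ (s / 2) ≤ 2 ^ σ * M ^ s * (1 + (τ * (ξ - M)) ^ 2) ^ (σ / 2) := by
  have hM₀ : 0 < M := by linarith
  rw [abs_of_neg hs] at hσ
  have hσ₀ : 0 < σ := by linarith
  have sq_rpow : ∀ a r : ℝ, 0 ≤ a → (a ^ 2) ^ (r / 2) = a ^ r := fun a r ha => by
    rw [← Real.rpow_natCast, ← Real.rpow_mul ha]
    congr 1
    push_cast
    ring
  rcases le_total (M / 2) ξ with hξ | hξ
  · have h₁ : (1 + ξ ^ 2) ^ (s / 2) ≤ (M / 2) ^ s := by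
      rw [← sq_rpow (M / 2) s (by positivity)]
      exact Real.rpow_le_rpow_of_nonpos (by positivity) (by nlinarith) (by linarith)
    have h₂ : (M / 2) ^ s ≤ 2 ^ σ * M ^ s := by
      rw [Real.div_rpow hM₀.le (by norm_num), div_eq_mul_inv, ← Real.rpow_neg (by norm_num),
        mul_comm]
      gcongr
      norm_num
    have h₃ : 1 ≤ (1 + (τ * (ξ - M)) ^ 2) ^ (σ / 2) :=
      Real.one_le_rpow (by nlinarith [sq_nonneg (τ * (ξ - M))]) (by positivity)
    exact (h₁.trans h₂).trans (le_mul_of_one_le_right (by positivity) h₃)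
  · have h₁ : (1 + ξ ^ 2) ^ (s / 2) ≤ 1 :=
      Real.rpow_le_one_of_one_le_of_nonpos (by nlinarith [sq_nonneg ξ]) (by linarith)
    have h₂ : M ^ (-s / σ) ≤ τ * M := by
      calc M ^ (-s / σ) = M ^ (-s / σ) * 1 := (mul_one _).symm
        _ ≤ M ^ (-s / σ) * (τ * M ^ (1 + s / σ)) := by gcongr
        _ = τ * (M ^ (-s / σ) * M ^ (1 + s / σ)) := by ring
        _ = τ * M := by
          rw [← Real.rpow_add hM₀, show -s / σ + (1 + s / σ) = 1 by ring, Real.rpow_one]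
    have h₃ : (M ^ (-s / σ) / 2) ^ σ ≤ (1 + (τ * (ξ - M)) ^ 2) ^ (σ / 2) := by
      rw [← sq_rpow _ σ (by positivity)]
      have h₄ : M ^ (-s / σ) / 2 ≤ τ * (M - ξ) := by nlinarith
      have h₅ : (M ^ (-s / σ) / 2) ^ 2 ≤ (τ * (M - ξ)) ^ 2 := by gcongr
      exact Real.rpow_le_rpow (by positivity) (by linarith) (by positivity)
    rw [Real.div_rpow (by positivity) (by norm_num), ← Real.rpow_mul hM₀.le,
      div_mul_cancel₀ _ hσ₀.ne'] at h₃
    calc (1 + ξ ^ 2) ^ (s / 2) ≤ 1 := h₁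
      _ = 2 ^ σ * M ^ s * (M ^ (-s) / 2 ^ σ) := by
        rw [Real.rpow_neg hM₀.le]
        field_simp
      _ ≤ _ := by gcongr

/-- `H^s` bound (`s < 0`, `σ ≥ |s|`) for high-frequency modulations: if
`1 ≤ τ · M^{1+s/σ}` then `v(x) = A e^{iMx} u((x-x₀)/τ)` satisfies
`‖v‖_{H^s} ≤ C₁ A τ^{1/2} M^s ‖u‖_{H^σ}`. -/
theorem stmt_17 (s σ : ℝ) (hs : s < 0) (hσ : |s| ≤ σ) :
    ∃ C₁ > (0:ℝ), ∀ u : SchwartzMap ℝ ℂ, ∀ A x₀ M τ : ℝ,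
      0 < A → 1 < M → 0 < τ → 1 ≤ τ * M ^ (1 + s/σ) →
      HsNorm s (fun x => (A : ℂ) * Complex.exp (Complex.I * M * x) * u ((x - x₀) / τ)) ≤
        ENNReal.ofReal (C₁ * A * τ ^ ((1:ℝ)/2) * M ^ s) * HsNorm σ (fun x => u x) := by
  refine ⟨2 ^ σ, by positivity, fun u A x₀ M τ hA hM hτ h => ?_⟩
  have hM₀ : 0 < M := by linarith
  set g : ℝ → ℂ := fun ξ => (((1 + ξ ^ 2) ^ (σ / 2) : ℝ) : ℂ) * fourierInt (fun x => u x) ξ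
  have key : ∀ ξ : ℝ,
      ‖(((1 + ξ ^ 2) ^ (s / 2) : ℝ) : ℂ) * fourierInt
        (fun x => (A : ℂ) * Complex.exp (Complex.I * M * x) * u ((x - x₀) / τ)) ξ‖ ≤
      (2 ^ σ * M ^ s * A * τ) * ‖g (τ * (ξ - M))‖ := by
    intro ξ
    have hexp : ‖Complex.exp (Complex.I * x₀ * (M - ξ))‖ = 1 := by
      rw [show Complex.I * x₀ * (M - ξ) = ((x₀ * (M - ξ) : ℝ) : ℂ) * Complex.I by
        push_cast; ring]
      exact Complex.norm_exp_ofReal_mul_I _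
    rw [fourierInt_modulation (fun x => u x) A x₀ M τ ξ hτ]
    simp only [g, norm_mul, hexp, Complex.norm_real, Real.norm_eq_abs, abs_of_pos hA,
      abs_of_pos hτ, mul_one]
    rw [abs_of_nonneg (by positivity), abs_of_nonneg (by positivity)]
    calc _ ≤ (2 ^ σ * M ^ s * (1 + (τ * (ξ - M)) ^ 2) ^ (σ / 2)) * (A * τ * _) :=
          mul_le_mul_of_nonneg_right (weight_le s σ M τ ξ hs hσ hM hτ h) (by positivity)
      _ = _ := by ring
  refine (eLpNorm_le_mul_eLpNorm_of_ae_le_mul (Filter.Eventually.of_forall key) 2).trans ?_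
  rw [eLpNorm_two_comp_affine g M τ hτ, ← mul_assoc, ← ENNReal.ofReal_mul (by positivity)]
  refine le_of_eq ?_
  have hpow : τ * τ ^ (-(1 : ℝ) / 2) = τ ^ ((1 : ℝ) / 2) := by
    rw [← Real.rpow_one_add' hτ.le (by norm_num)]
    norm_num
  have hconst : 2 ^ σ * M ^ s * A * τ * τ ^ (-(1 : ℝ) / 2) =
      2 ^ σ * A * τ ^ ((1 : ℝ) / 2) * M ^ s := by
    rw [← hpow]
    ring
  rw [hconst]
  rfl
end

section
/- Let N > 0 and let u : ℝ_s × ℝ_y → ℂ be a smooth function satisfying the defocusing cubic Schrödinger equation i ∂_s u − ∂_y² u + |u|² u = 0 on ℝ × ℝ. Define U(t,x) = e^{i(N⁴ t + N x)} u(t, x/(√6 N) + (4/√6) N² t). Then for all (t,x) ∈ ℝ × ℝ, i ∂_t U(t,x) + ∂_x⁴ U(t,x) + |U(t,x)|² U(t,x) = (1/36) N^{-4} e^{i(N⁴ t + N x)} (∂_y⁴ u)(s,y) + (4 i / 6^{3/2}) N^{-2} e^{i(N⁴ t + N x)} (∂_y³ u)(s,y), where (s,y) = (t, x/(√6 N)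 + (4/√6) N² t). -/
open Complex

/-- Differentiating a modulated, rescaled function amounts to applying `ik + a ∂` to the profile. -/
lemma deriv_exp_mul_comp_affine (w : ℂ) (k a b : ℝ) {f : ℝ → ℂ} (hf : Differentiable ℝ f) :
    deriv (fun x : ℝ => exp (I * (w + k * x)) * f (a * x + b)) =
      fun x : ℝ => exp (I * (w + k * x)) * (I * k * f (a * x + b) + a * deriv f (a * x + b)) := by
  funext x
  have hlin : HasDerivAt (fun x : ℝ => I * (w + k * (x : ℂ))) (I * k) x := by
    simpa using (((hasDerivAt_id x).ofReal_comp.const_mul (k : ℂ)).const_add w).const_mul I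
  have haff : HasDerivAt (fun x : ℝ => a * x + b) a x := by
    simpa using ((hasDerivAt_id x).const_mul a).add_const b
  have hcomp : HasDerivAt (fun x : ℝ => f (a * x + b)) (a • deriv f (a * x + b)) x :=
    (hf (a * x + b)).hasDerivAt.scomp x haff
  refine (hlin.cexp.mul hcomp).deriv.trans ?_
  rw [real_smul]
  ring

/-- The fourth derivative of a modulated, rescaled function. -/
lemma iterate_four_deriv_exp_mul_comp_affine (w : ℂ) (k a b : ℝ) {f : ℝ → ℂ}
    (hf : ContDiff ℝ (⊤ : ℕ∞) f) (x : ℝ) :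
    deriv^[4] (fun x : ℝ => exp (I * (w + k * x)) * f (a * x + b)) x =
      exp (I * (w + k * x)) * (k ^ 4 * f (a * x + b) - 4 * I * k ^ 3 * a * deriv f (a * x + b)
        - 6 * k ^ 2 * a ^ 2 * deriv (deriv f) (a * x + b)
        + 4 * I * k * a ^ 3 * deriv^[3] f (a * x + b) + a ^ 4 * deriv^[4] f (a * x + b)) := by
  have hd {g : ℝ → ℂ} (hg : ContDiff ℝ (⊤ : ℕ∞) g) : Differentiable ℝ g :=
    hg.differentiable (by simp)
  have hs {g : ℝ → ℂ} (hg : ContDiff ℝ (⊤ : ℕ∞) g) : ContDiff ℝ (⊤ : ℕ∞) (deriv g) :=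
    (contDiff_infty_iff_deriv.1 hg).2
  let T : (ℝ → ℂ) → ℝ → ℂ := fun g y => I * k * g y + a * deriv g y
  have hT {g : ℝ → ℂ} (hg : ContDiff ℝ (⊤ : ℕ∞) g) : ContDiff ℝ (⊤ : ℕ∞) (T g) :=
    (contDiff_const.mul hg).add (contDiff_const.mul (hs hg))
  have hstep {g : ℝ → ℂ} (hg : ContDiff ℝ (⊤ : ℕ∞) g) :
      deriv (fun x : ℝ => exp (I * (w + k * x)) * g (a * x + b)) =
        fun x : ℝ => exp (I * (w + k * x)) * T g (a * x + b) :=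
    deriv_exp_mul_comp_affine w k a b (hd hg)
  have hderiv {g : ℝ → ℂ} (hg : ContDiff ℝ (⊤ : ℕ∞) g) : deriv (T g) = T (deriv g) := by
    funext y
    exact ((((hd hg) y).hasDerivAt.const_mul (I * k)).add
      (((hd (hs hg)) y).hasDerivAt.const_mul (a : ℂ))).deriv
  have hTapp (g : ℝ → ℂ) (y : ℝ) : T g y = I * k * g y + a * deriv g y := rfl
  have h1 := hs hf
  have h2 := hs h1
  have h3 := hs h2
  simp only [Function.iterate_succ, Function.iterate_zero, Function.comp_apply, id]
  rw [hstep hf, hstep (hT hf), hstep (hT (hT hf)), hstep (hT (hT (hT hf)))]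
  simp only [hTapp, hderiv (hT (hT hf)), hderiv (hT hf), hderiv hf, hderiv (hT h1),
    hderiv h1, hderiv h2]
  have hI3 : I ^ 3 = -I := by rw [pow_succ, I_sq]; ring
  have hI4 : I ^ 4 = 1 := I_pow_four
  ring_nf
  simp only [hI3, hI4, I_sq]
  ring

/-- The derivative of a two-variable function along a non-vertical line. -/
lemma hasDerivAt_along_line {u : ℝ → ℝ → ℂ}
    (hu : Differentiable ℝ (fun p : ℝ × ℝ => u p.1 p.2)) (b c t : ℝ) :
    HasDerivAt (fun t' => u t' (b + c * t'))
      (deriv (fun s' => u s' (b + c * t)) t + c * deriv (fun y' => u t y') (b + c * t)) t := by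
  have hF := (hu (t, b + c * t)).hasFDerivAt
  set L := fderiv ℝ (fun p : ℝ × ℝ => u p.1 p.2) (t, b + c * t)
  have hs : HasDerivAt (fun s' => u s' (b + c * t)) (L (1, 0)) t :=
    HasFDerivAt.comp_hasDerivAt (f := fun s' : ℝ => (s', b + c * t)) t hF
      ((hasDerivAt_id t).prodMk (hasDerivAt_const t _))
  have hy : HasDerivAt (fun y' => u t y') (L (0, 1)) (b + c * t) :=
    HasFDerivAt.comp_hasDerivAt (f := fun y' : ℝ => (t, y')) (b + c * t) hF
      ((hasDerivAt_const _ t).prodMk (hasDerivAt_id _))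
  have haff : HasDerivAt (fun t' : ℝ => b + c * t') c t := by
    simpa using ((hasDerivAt_id t).const_mul c).const_add b
  have hline : HasDerivAt (fun t' => u t' (b + c * t')) (L (1, c)) t :=
    HasFDerivAt.comp_hasDerivAt (f := fun t' : ℝ => (t', b + c * t')) t hF
      ((hasDerivAt_id t).prodMk haff)
  have hsplit : ((1, c) : ℝ × ℝ) = (1, 0) + c • (0, 1) := by simp
  rw [hsplit, map_add, map_smul, real_smul] at hline
  rwa [hs.deriv, hy.deriv]

/-- The modulated, rescaled NLS solution
`U(t,x) = e^{i(N⁴t+Nx)} u(t, x/(√6 N) + (4/√6)N²t)` is an approximate solution of the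
focusing fourth order cubic NLS: if `u` solves the defocusing cubic NLS
`i∂_s u − ∂_y²u + |u|²u = 0`, then
`i∂_t U + ∂_x⁴U + |U|²U = (1/36)N⁻⁴ e^{i(N⁴t+Nx)} ∂_y⁴u(s,y)
  + (4i/6^{3/2}) N⁻² e^{i(N⁴t+Nx)} ∂_y³u(s,y)` with `(s,y)` as given. -/
theorem stmt_19 (N : ℝ) (hN : 0 < N) (u : ℝ → ℝ → ℂ)
    (hu : ContDiff ℝ (⊤ : ℕ∞) (fun p : ℝ × ℝ => u p.1 p.2))
    (hNLS : ∀ s y : ℝ,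
      Complex.I * deriv (fun s' => u s' y) s - deriv (deriv (fun y' => u s y')) y +
        u s y * (starRingEnd ℂ) (u s y) * u s y = 0)
    (U : ℝ → ℝ → ℂ)
    (hU : ∀ t x : ℝ, U t x =
      Complex.exp (Complex.I * ((N:ℂ)^4 * t + N * x)) *
        u t (x / (Real.sqrt 6 * N) + (4 / Real.sqrt 6) * N^2 * t)) :
    ∀ t x : ℝ,
      Complex.I * deriv (fun t' => U t' x) t + deriv^[4] (fun x' => U t x') x +
          U t x * (starRingEnd ℂ) (U t x) * U t x =
        ((1:ℂ)/36) * ((N:ℂ)^4)⁻¹ * Complex.exp (Complex.I * ((N:ℂ)^4 * t + N * x)) *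
            deriv^[4] (fun y' => u t y')
              (x / (Real.sqrt 6 * N) + (4 / Real.sqrt 6) * N^2 * t) +
          (4 * Complex.I / (((6:ℝ) ^ ((3:ℝ)/2) : ℝ) : ℂ)) * ((N:ℂ)^2)⁻¹ *
            Complex.exp (Complex.I * ((N:ℂ)^4 * t + N * x)) *
            deriv^[3] (fun y' => u t y')
              (x / (Real.sqrt 6 * N) + (4 / Real.sqrt 6) * N^2 * t) := by
  intro t x
  set r : ℝ := Real.sqrt 6 with hr
  have hr_pos : 0 < r := Real.sqrt_pos.2 (by norm_num)
  have hr_sq : (r : ℂ) ^ 2 = 6 := by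
    rw [← ofReal_pow, hr, Real.sq_sqrt (by norm_num)]; norm_num
  have hrC : (r : ℂ) ≠ 0 := ofReal_ne_zero.2 hr_pos.ne'
  have hNC : (N : ℂ) ≠ 0 := ofReal_ne_zero.2 hN.ne'
  have hpow : (6 : ℝ) ^ ((3 : ℝ) / 2) = r ^ 3 := by
    rw [hr, Real.sqrt_eq_rpow, ← Real.rpow_mul_natCast (by norm_num)]; norm_num
  set y : ℝ := x / (r * N) + (4 / r) * N ^ 2 * t with hy
  set e : ℂ := exp (I * ((N : ℂ) ^ 4 * t + N * x)) with he
  have hux : ContDiff ℝ (⊤ : ℕ∞) (fun y' => u t y') := hu.comp (contDiff_prodMk_right t)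
  have hUt : deriv (fun t' => U t' x) t = e * (I * N ^ 4 * u t y +
      (deriv (fun s' => u s' y) t +
        ((4 / r * N ^ 2 : ℝ) : ℂ) * deriv (fun y' => u t y') y)) := by
    have hlin : HasDerivAt (fun t' : ℝ => I * ((N : ℂ) ^ 4 * t' + N * x)) (I * N ^ 4) t := by
      simpa using
        (((hasDerivAt_id t).ofReal_comp.const_mul ((N : ℂ) ^ 4)).add_const (N * x : ℂ)).const_mul I
    have hline := hasDerivAt_along_line (hu.differentiable (by simp))
      (x / (r * N)) (4 / r * N ^ 2) t
    rw [show (fun t' => U t' x) = _ from funext fun t' => hU t' x]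
    refine (hlin.cexp.mul hline).deriv.trans ?_
    rw [← hy, ← he]
    ring
  have haff : (fun x' => U t x') = fun x' : ℝ => exp (I * ((N : ℂ) ^ 4 * t + N * x')) *
      u t (1 / (r * N) * x' + 4 / r * N ^ 2 * t) := by
    funext x'
    rw [hU, one_div_mul_eq_div]
  have hUx := iterate_four_deriv_exp_mul_comp_affine ((N : ℂ) ^ 4 * t) N (1 / (r * N))
    (4 / r * N ^ 2 * t) hux x
  rw [← haff] at hUx
  rw [one_div_mul_eq_div, ← hy, ← he] at hUx
  have he_conj : e * (starRingEnd ℂ) e = 1 := by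
    rw [he, ← exp_conj, ← exp_add, ← exp_zero]
    congr 1
    simp
  have hUU : U t x * (starRingEnd ℂ) (U t x) * U t x =
      e * (u t y * (starRingEnd ℂ) (u t y) * u t y) := by
    rw [hU t x, ← hy, ← he, map_mul]
    linear_combination e * u t y * (starRingEnd ℂ) (u t y) * u t y * he_conj
  rw [hUt, hUx, hUU, hpow]
  have hI := I_mul_I
  have hc1 : (N : ℂ) ^ 3 * ((1 / (r * N) : ℝ) : ℂ) = N ^ 2 / r := by
    push_cast; field_simp
  have hc2 : 6 * (N : ℂ) ^ 2 * ((1 / (r * N) : ℝ) : ℂ) ^ 2 = 1 := by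
    push_cast; field_simp; exact hr_sq.symm
  have hc3 : (N : ℂ) * ((1 / (r * N) : ℝ) : ℂ) ^ 3 = ((r ^ 3 : ℝ) : ℂ)⁻¹ * (N ^ 2 : ℂ)⁻¹ := by
    push_cast; field_simp
  have hc4 : ((1 / (r * N) : ℝ) : ℂ) ^ 4 = 1 / 36 * (N ^ 4 : ℂ)⁻¹ := by
    have hr4 : (r : ℂ) ^ 4 = 36 := by linear_combination (r ^ 2 + 6 : ℂ) * hr_sq
    push_cast; field_simp; rw [hr4]
  have hct : ((4 / r * N ^ 2 : ℝ) : ℂ) = 4 * (N ^ 2 / r) := by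
    push_cast; ring
  rw [hct]
  linear_combination e * hNLS t y + e * N ^ 4 * u t y * hI
    - 4 * I * e * deriv (fun y' => u t y') y * hc1
    - e * deriv (deriv fun y' => u t y') y * hc2
    + 4 * I * e * deriv^[3] (fun y' => u t y') y * hc3
    + e * deriv^[4] (fun y' => u t y') y * hc4
end
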